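/- For every p ∈ [0,1], the 3-dimensional Grimmett random-orientation model confined to the slab Z² × {−1,0,1} percolates: with strictly positive probability there exists an infinite directed self-avoiding path starting at the origin using only vertices of the slab. -/

import Mathlib

open MeasureTheory ENNReal

namespace RandomOrientation

/-- One step of the base-`(p, 1-p)` expansion map on `[0,1)`. -/
noncomputable def expand (p x : ℝ) : ℝ := if x < p then x / p else (x - p) / (1 - p)

/-- The `n`-th digit of the Bernoulli(`p`) expansion of `x`: for `x` uniformly
distributed on `[0,1)` the digits are i.i.d. `{true, false}`-valued with
`P(true) = p`. -/
noncomputable def bernDigit (p : ℝ) (n : ℕ) (x : ℝ) : Bool :=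
  decide ((expand p)^[n] x < p)

/-- The product over the countable index set `I` of Bernoulli(`p`) measures on
`Bool` (`P(true) = p`), realized as the joint distribution of the digits of the
Bernoulli(`p`) expansion of a uniform random point of `[0,1)`. -/
noncomputable def bernoulliProduct (I : Type*) [Encodable I] (p : ℝ) :
    Measure (I → Bool) :=
  Measure.map (fun x i => bernDigit p (Encodable.encode i) x)
    (volume.restrict (Set.Ico (0 : ℝ) 1))

/-- Edges of `ℤ³`: `(v, i)` is the edge from `v` to `v + eᵢ`. -/
abbrev Edge3 : Type := (ℤ × ℤ × ℤ) × Fin 3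

/-- An orientation configuration of the edges of `ℤ³`. -/
abbrev Config3 : Type := Edge3 → Bool

def e3Src (e : Edge3) : ℤ × ℤ × ℤ := e.1

def e3Dst (e : Edge3) : ℤ × ℤ × ℤ :=
  if e.2 = 0 then (e.1.1 + 1, e.1.2.1, e.1.2.2)
  else if e.2 = 1 then (e.1.1, e.1.2.1 + 1, e.1.2.2)
  else (e.1.1, e.1.2.1, e.1.2.2 + 1)

/-- The law of the `3`-dimensional random orientation with parameter `p`: each
edge independently carries the bit `true` with probability `p`. -/
noncomputable def mu3 (p : ℝ) : Measure Config3 := bernoulliProduct Edge3 p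

/-- The directed-edge relation of the `3`-dimensional Grimmett model:
`ω e = true` means `e` is oriented in the positive coordinate direction,
`ω e = false` in the negative one. -/
def gStep3 (ω : Config3) (u v : ℤ × ℤ × ℤ) : Prop :=
  ∃ e : Edge3, (e3Src e = u ∧ e3Dst e = v ∧ ω e = true) ∨
    (e3Src e = v ∧ e3Dst e = u ∧ ω e = false)

/-- There is an infinite directed self-avoiding path starting at the origin,
all of whose vertices lie in `S`, for the directed-step relation `R`. -/
def percolates3 (R : ℤ × ℤ × ℤ → ℤ × ℤ × ℤ → Prop) (S : Set (ℤ × ℤ × ℤ)) : Prop :=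
  ∃ γ : ℕ → ℤ × ℤ × ℤ, γ 0 = (0, 0, 0) ∧ Function.Injective γ ∧
    (∀ n, R (γ n) (γ (n + 1))) ∧ ∀ n, γ n ∈ S

/-- The slab `ℤ² × {-1, 0, 1}`. -/
def slab : Set (ℤ × ℤ × ℤ) := {v | v.2.2 = -1 ∨ v.2.2 = 0 ∨ v.2.2 = 1}

section Product

open Measure ProbabilityTheory

/-- The event `A` depends only on the coordinates in `I`. -/
def DeterminedBy {ι X : Type*} (I : Set ι) (A : Set (ι → X)) : Prop :=
  ∀ ω ω' : ι → X, (∀ i ∈ I, ω i = ω' i) → ω ∈ A → ω' ∈ A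

variable {ι X : Type*}

lemma DeterminedBy.iff {I : Set ι} {A : Set (ι → X)} (h : DeterminedBy I A) {ω ω' : ι → X}
    (hω : ∀ i ∈ I, ω i = ω' i) : ω ∈ A ↔ ω' ∈ A :=
  ⟨h ω ω' hω, h ω' ω fun i hi => (hω i hi).symm⟩

lemma DeterminedBy.mono {I J : Set ι} {A : Set (ι → X)} (h : DeterminedBy I A) (hIJ : I ⊆ J) :
    DeterminedBy J A :=
  fun ω ω' hω => h ω ω' fun i hi => hω i (hIJ hi)

lemma DeterminedBy.inter {I J : Set ι} {A B : Set (ι → X)} (hA : DeterminedBy I A)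
    (hB : DeterminedBy J B) : DeterminedBy (I ∪ J) (A ∩ B) :=
  fun ω ω' hω h => ⟨hA ω ω' (fun i hi => hω i (Or.inl hi)) h.1,
    hB ω ω' (fun i hi => hω i (Or.inr hi)) h.2⟩

variable [MeasurableSpace X]

/-- An event determined by the coordinates in `I` only sees the marginals on `I`. -/
lemma infinitePi_congr_of_determinedBy [Nonempty X] {μ ν : ι → Measure X}
    [∀ i, IsProbabilityMeasure (μ i)] [∀ i, IsProbabilityMeasure (ν i)] {I : Set ι}
    (h : ∀ i ∈ I, μ i = ν i) {A : Set (ι → X)} (hA : MeasurableSet A) (hI : DeterminedBy I A) :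
    infinitePi μ A = infinitePi ν A := by
  classical
  obtain ⟨x₀⟩ := ‹Nonempty X›
  let ext : (I → X) → ι → X := fun ω i => if hi : i ∈ I then ω ⟨i, hi⟩ else x₀
  have hext : Measurable ext := by
    refine measurable_pi_lambda _ fun i => ?_
    by_cases hi : i ∈ I
    · simpa [ext, hi] using measurable_pi_apply _
    · simp [ext, hi]
  have hpre : (fun (ω : ι → X) (i : I) => ω i) ⁻¹' (ext ⁻¹' A) = A := by
    ext ω
    exact hI.iff fun i hi => by simp [ext, hi]
  have key (ρ : ι → Measure X) [∀ i, IsProbabilityMeasure (ρ i)] :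
      infinitePi ρ A = infinitePi (fun i : I => ρ i) (ext ⁻¹' A) := by
    rw [← map_infinitePi_infinitePi_of_inj (P := ρ) Subtype.val_injective,
      map_apply (by fun_prop) (hext hA), hpre]
  rw [key μ, key ν]
  congr 2
  exact funext fun i => h i i.2

/-- Events determined by disjoint sets of coordinates are independent. -/
lemma infinitePi_inter_of_determinedBy [Nonempty X] {μ : ι → Measure X}
    [∀ i, IsProbabilityMeasure (μ i)] {I J : Set ι} (hIJ : Disjoint I J) {A B : Set (ι → X)}
    (hA : MeasurableSet A) (hB : MeasurableSet B) (hI : DeterminedBy I A)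
    (hJ : DeterminedBy J B) :
    infinitePi μ (A ∩ B) = infinitePi μ A * infinitePi μ B := by
  classical
  obtain ⟨x₀⟩ := ‹Nonempty X›
  have hind : iIndepFun (fun i (ω : ι → X) => ω i) (infinitePi μ) :=
    iIndepFun_infinitePi (X := fun _ x => x) fun _ => measurable_id
  have h := indep_iSup_of_disjoint (m := fun i => MeasurableSpace.comap
    (fun ω : ι → X => ω i) inferInstance) (fun i => (measurable_pi_apply i).comap_le) hind hIJ
  have meas (K : Set ι) {C : Set (ι → X)} (hC : MeasurableSet C) (hK : DeterminedBy K C) :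
      MeasurableSet[⨆ i ∈ K, MeasurableSpace.comap (fun ω : ι → X => ω i) inferInstance] C := by
    have hg : Measurable[⨆ i ∈ K, MeasurableSpace.comap (fun ω : ι → X => ω i) inferInstance]
        (fun (ω : ι → X) i => if i ∈ K then ω i else x₀) := by
      refine @measurable_pi_lambda _ _ _ (_) _ _ fun i => ?_
      by_cases hi : i ∈ K
      · simp only [hi, if_true]
        exact (comap_measurable (fun ω : ι → X => ω i)).mono
          (le_iSup₂_of_le i hi le_rfl) le_rfl
      · simp only [hi, if_false]
        exact measurable_const
    have : (fun (ω : ι → X) i => if i ∈ K then ω i else x₀) ⁻¹' C = C := by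
      ext ω
      exact hK.iff fun i hi => by simp [hi]
    rw [← this]
    exact hg hC
  exact (Indep_iff _ _ _).1 h A B (meas I hA hI) (meas J hB hJ)

lemma measurable_update_prod [DecidableEq ι] (e : ι) :
    Measurable fun x : (ι → X) × X => Function.update x.1 e x.2 := by
  refine measurable_pi_lambda _ fun i => ?_
  by_cases hi : i = e
  · subst hi
    simpa using measurable_snd
  · simp only [Function.update_of_ne hi]
    exact (measurable_pi_apply i).comp measurable_fst

/-- Resampling one coordinate of a product measure changes the corresponding factor. -/
lemma infinitePi_update_apply [DecidableEq ι] (μ : ι → Measure X)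
    [∀ i, IsProbabilityMeasure (μ i)] (e : ι) (ν : Measure X) [IsProbabilityMeasure ν]
    [∀ i, IsProbabilityMeasure (Function.update μ e ν i)] {A : Set (ι → X)}
    (hA : MeasurableSet A) :
    infinitePi (Function.update μ e ν) A =
      ∫⁻ ω, ν {z | Function.update ω e z ∈ A} ∂infinitePi μ := by
  have hmap : ((infinitePi μ).prod ν).map (fun x => Function.update x.1 e x.2) =
      infinitePi (Function.update μ e ν) := by
    refine eq_infinitePi _ fun s t ht => ?_
    rw [map_apply (measurable_update_prod e)
      (MeasurableSet.pi s.countable_toSet fun i _ => ht i)]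
    have hpre : (fun x : (ι → X) × X => Function.update x.1 e x.2) ⁻¹' ((s : Set ι).pi t) =
        ((s.erase e : Finset ι) : Set ι).pi t ×ˢ (if e ∈ s then t e else Set.univ) := by
      ext ⟨ω, z⟩
      simp only [Set.mem_preimage, Set.mem_pi, Set.mem_prod, Finset.mem_coe, Finset.mem_erase]
      constructor
      · intro h
        refine ⟨fun i hi => by simpa [hi.1] using h i hi.2, ?_⟩
        split_ifs with he
        · simpa using h e he
        · trivial
      · rintro ⟨h₁, h₂⟩ i hi
        by_cases hie : i = e
        · subst hie
          simpa [hi] using h₂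
        · simpa [hie] using h₁ i ⟨hie, hi⟩
    rw [hpre, prod_prod, infinitePi_pi _ fun i _ => ht i]
    have hne : ∏ i ∈ s.erase e, μ i (t i) =
        ∏ i ∈ s.erase e, Function.update μ e ν i (t i) :=
      Finset.prod_congr rfl fun i hi => by
        rw [Function.update_of_ne (Finset.ne_of_mem_erase hi)]
    by_cases he : e ∈ s
    · rw [← Finset.prod_erase_mul _ _ he, hne]
      simp [he]
    · simp only [he, if_false, measure_univ, mul_one]
      rw [hne, Finset.erase_eq_of_notMem he]
  rw [← hmap, map_apply (measurable_update_prod e) hA,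
    prod_apply (measurable_update_prod e hA)]
  rfl

end Product

section Bernoulli

open Measure

/-- The Bernoulli measure on `Bool` giving `true` probability `q`, truncated to `[0, 1]`. -/
noncomputable def bern (q : ℝ) : Measure Bool :=
  ENNReal.ofReal (max 0 (min q 1)) • dirac true +
    ENNReal.ofReal (1 - max 0 (min q 1)) • dirac false

instance (q : ℝ) : IsProbabilityMeasure (bern q) := by
  constructor
  simp only [bern, Measure.coe_add, Measure.coe_smul, Pi.add_apply, Pi.smul_apply, measure_univ,
    smul_eq_mul, mul_one]
  rw [← ENNReal.ofReal_add (le_max_left _ _) (by simp)]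
  simp

lemma bern_apply {q : ℝ} (h₀ : 0 ≤ q) (h₁ : q ≤ 1) (B : Set Bool) :
    bern q B = ENNReal.ofReal q * B.indicator 1 true +
      ENNReal.ofReal (1 - q) * B.indicator 1 false := by
  simp [bern, min_eq_left h₁, max_eq_right h₀]

/-- The law of independent bits, the bit `e` being `true` with probability `q e`. -/
noncomputable def bernPi {ι : Type*} (q : ι → ℝ) : Measure (ι → Bool) :=
  infinitePi fun e => bern (q e)

instance {ι : Type*} (q : ι → ℝ) : IsProbabilityMeasure (bernPi q) := by
  unfold bernPi
  infer_instance

/-- The event that `A` occurs once the bit `e` is set to `b`. -/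
def force {ι : Type*} [DecidableEq ι] (e : ι) (b : Bool) (A : Set (ι → Bool)) :
    Set (ι → Bool) :=
  (fun ω => Function.update ω e b) ⁻¹' A

variable {ι : Type*}

/-- Increasing events. -/
def Increasing (A : Set (ι → Bool)) : Prop :=
  ∀ ω ω' : ι → Bool, (∀ e, ω e = true → ω' e = true) → ω ∈ A → ω' ∈ A

lemma bernPi_congr {q r : ι → ℝ} {I : Set ι} (h : ∀ e ∈ I, q e = r e) {A : Set (ι → Bool)}
    (hA : MeasurableSet A) (hI : DeterminedBy I A) : bernPi q A = bernPi r A :=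
  infinitePi_congr_of_determinedBy (fun e he => by rw [h e he]) hA hI

lemma bernPi_real_inter {q : ι → ℝ} {I J : Set ι} (hIJ : Disjoint I J)
    {A B : Set (ι → Bool)} (hA : MeasurableSet A) (hB : MeasurableSet B) (hI : DeterminedBy I A)
    (hJ : DeterminedBy J B) :
    (bernPi q).real (A ∩ B) = (bernPi q).real A * (bernPi q).real B := by
  simp only [measureReal_def, ← ENNReal.toReal_mul]
  rw [bernPi, infinitePi_inter_of_determinedBy hIJ hA hB hI hJ]

lemma measurableSet_eval_true (e : ι) : MeasurableSet {ω : ι → Bool | ω e = true} :=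
  measurableSet_eq_fun (measurable_pi_apply e) measurable_const

lemma bernPi_real_eval {q : ι → ℝ} (e : ι) (h₀ : 0 ≤ q e) (h₁ : q e ≤ 1) :
    (bernPi q).real {ω | ω e = true} = q e := by
  have h := infinitePi_map_eval (fun e => bern (q e)) e
  have h' : bernPi q {ω | ω e = true} = bern (q e) {true} := by
    rw [← h, map_apply (measurable_pi_apply e) (measurableSet_singleton _)]
    rfl
  rw [measureReal_def, h', bern_apply h₀ h₁]
  simp [h₀]

variable [DecidableEq ι]

lemma measurable_update_const (e : ι) (b : Bool) :
    Measurable fun ω : ι → Bool => Function.update ω e b :=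
  (measurable_update_prod e).comp (measurable_id.prodMk measurable_const)

lemma measurableSet_force {A : Set (ι → Bool)} (hA : MeasurableSet A) (e : ι) (b : Bool) :
    MeasurableSet (force e b A) :=
  measurable_update_const e b hA

lemma force_comm {e f : ι} (h : e ≠ f) (b c : Bool) (A : Set (ι → Bool)) :
    force e b (force f c A) = force f c (force e b A) := by
  ext ω
  simp only [force, Set.mem_preimage]
  rw [Function.update_comm h]

lemma DeterminedBy.force {I J : Set ι} {A : Set (ι → Bool)} (hA : DeterminedBy I A) {e : ι}
    (hJ : ∀ i ∈ I, i ≠ e → i ∈ J) (b : Bool) : DeterminedBy J (force e b A) := by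
  intro ω ω' h
  refine hA _ _ fun i hi => ?_
  by_cases hie : i = e
  · subst hie
    simp
  · simpa [hie] using h i (hJ i hi hie)

lemma bernPi_real_eq_force (q : ι → ℝ) (e : ι) (h₀ : 0 ≤ q e) (h₁ : q e ≤ 1)
    {A : Set (ι → Bool)} (hA : MeasurableSet A) :
    (bernPi q).real A = q e * (bernPi q).real (force e true A) +
      (1 - q e) * (bernPi q).real (force e false A) := by
  have hself : Function.update (fun e => bern (q e)) e (bern (q e)) = fun e => bern (q e) :=
    Function.update_eq_self e _
  have inst : ∀ i, IsProbabilityMeasure (Function.update (fun e => bern (q e)) e (bern (q e)) i) :=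
    fun i => by rw [hself]; infer_instance
  have h : bernPi q A = ENNReal.ofReal (q e) * bernPi q (force e true A) +
      ENNReal.ofReal (1 - q e) * bernPi q (force e false A) := by
    have h := infinitePi_update_apply (fun e => bern (q e)) e (bern (q e)) hA
    simp only [hself] at h
    rw [bernPi, h]
    simp only [bern_apply h₀ h₁]
    rw [lintegral_add_left, lintegral_const_mul, lintegral_const_mul]
    · congr 2
      · rw [← lintegral_indicator_one (measurableSet_force hA e true)]
        rfl
      · rw [← lintegral_indicator_one (measurableSet_force hA e false)]
        rfl
    · exact (measurable_const.indicator (measurableSet_force hA e false))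
    · exact (measurable_const.indicator (measurableSet_force hA e true))
    · exact (measurable_const.indicator (measurableSet_force hA e true)).const_mul _
  rw [measureReal_def, h, ENNReal.toReal_add, ENNReal.toReal_mul, ENNReal.toReal_mul,
    ENNReal.toReal_ofReal h₀, ENNReal.toReal_ofReal (by linarith)]
  · rfl
  · exact ENNReal.mul_ne_top ENNReal.ofReal_ne_top (measure_ne_top _ _)
  · exact ENNReal.mul_ne_top ENNReal.ofReal_ne_top (measure_ne_top _ _)

/-- Russo's formula along a line of parameters of constant speed `δ`. -/
lemma hasDerivWithinAt_bernPi_real {q : ι → ℝ} {δ : ℝ}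
    (hq : ∀ t ∈ Set.Icc (0 : ℝ) 1, ∀ e, q e + t * δ ∈ Set.Icc (0 : ℝ) 1) (F : Finset ι)
    {A : Set (ι → Bool)} (hA : MeasurableSet A) (hF : DeterminedBy (F : Set ι) A) {t : ℝ}
    (ht : t ∈ Set.Icc (0 : ℝ) 1) :
    HasDerivWithinAt (fun s => (bernPi fun e => q e + s * δ).real A)
      (δ * ∑ e ∈ F, ((bernPi fun e => q e + t * δ).real (force e true A) -
        (bernPi fun e => q e + t * δ).real (force e false A))) (Set.Icc 0 1) t := by
  induction F using Finset.induction_on generalizing A with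
  | empty =>
    have hconst (s : ℝ) : (bernPi fun e => q e + s * δ).real A = (bernPi q).real A := by
      rw [measureReal_def, measureReal_def, bernPi_congr (I := ∅) (by simp) hA (by simpa using hF)]
    simp only [hconst, Finset.sum_empty, mul_zero]
    exact hasDerivWithinAt_const _ _ _
  | insert f F hf ih =>
    have hdet (b : Bool) : DeterminedBy (F : Set ι) (force f b A) :=
      hF.force (fun i hi hif => by simpa [hif] using hi) b
    have hline : HasDerivWithinAt (fun s : ℝ => q f + s * δ) δ (Set.Icc 0 1) t := by
      simpa using ((hasDerivWithinAt_id t (Set.Icc 0 1)).mul_const δ).const_add (q f)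
    have h₁ := hline.mul (ih (measurableSet_force hA f true) (hdet true))
    have h₀ := (hline.const_sub 1).mul (ih (measurableSet_force hA f false) (hdet false))
    refine ((h₁.add h₀).congr_of_mem (fun s hs => ?_) ht).congr_deriv ?_
    · exact bernPi_real_eq_force (fun e => q e + s * δ) f (hq s hs f).1 (hq s hs f).2 hA
    · rw [Finset.sum_insert hf]
      have hsum : ∑ e ∈ F, ((bernPi fun e => q e + t * δ).real (force e true A) -
          (bernPi fun e => q e + t * δ).real (force e false A)) =
          (q f + t * δ) * (∑ e ∈ F, ((bernPi fun e => q e + t * δ).real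
            (force e true (force f true A)) -
            (bernPi fun e => q e + t * δ).real (force e false (force f true A)))) +
          (1 - (q f + t * δ)) * (∑ e ∈ F, ((bernPi fun e => q e + t * δ).real
            (force e true (force f false A)) -
            (bernPi fun e => q e + t * δ).real (force e false (force f false A)))) := by
        rw [Finset.mul_sum, Finset.mul_sum, ← Finset.sum_add_distrib]
        refine Finset.sum_congr rfl fun e he => ?_
        have hef : e ≠ f := fun h => hf (h ▸ he)
        have key (b : Bool) := bernPi_real_eq_force (fun e => q e + t * δ) f (hq t ht f).1
          (hq t ht f).2 (measurableSet_force hA e b)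
        rw [key true, key false]
        simp only [force_comm hef]
        ring
      rw [hsum]
      ring

lemma Increasing.force_false_subset {A : Set (ι → Bool)} (hA : Increasing A) (e : ι) :
    force e false A ⊆ A := by
  refine fun ω h => hA _ _ (fun f hf => ?_) h
  by_cases hfe : f = e
  · subst hfe
    simp at hf
  · simpa [hfe] using hf

lemma Increasing.subset_force_true {A : Set (ι → Bool)} (hA : Increasing A) (e : ι) :
    A ⊆ force e true A := by
  refine fun ω h => hA ω _ (fun f hf => ?_) h
  by_cases hfe : f = e
  · subst hfe
    simp
  · simpa [hfe] using hf

/-- The probability of an increasing event grows with the parameters. -/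
lemma bernPi_real_mono {q : ι → ℝ} {δ : ℝ} (hδ : 0 ≤ δ)
    (hq : ∀ t ∈ Set.Icc (0 : ℝ) 1, ∀ e, q e + t * δ ∈ Set.Icc (0 : ℝ) 1) (F : Finset ι)
    {A : Set (ι → Bool)} (hA : MeasurableSet A) (hF : DeterminedBy (F : Set ι) A)
    (hinc : Increasing A) {t : ℝ} (ht : t ∈ Set.Icc (0 : ℝ) 1) :
    (bernPi q).real A ≤ (bernPi fun e => q e + t * δ).real A := by
  have hd := fun s hs => hasDerivWithinAt_bernPi_real hq F hA hF (t := s) hs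
  have hmono := monotoneOn_of_hasDerivWithinAt_nonneg (convex_Icc (0 : ℝ) 1)
    (fun s hs => (hd s hs).continuousWithinAt)
    (fun s hs => (hd s (interior_subset hs)).mono interior_subset)
    (fun s _ => mul_nonneg hδ (Finset.sum_nonneg fun e _ => sub_nonneg.2 (measureReal_mono
      ((hinc.force_false_subset e).trans (hinc.subset_force_true e)))))
  simpa using hmono (by simp) ht ht.1

end Bernoulli

section Graph

/-- A directed multigraph with vertices `V` and edges `ι`. -/
structure Graph (V ι : Type*) where
  src : ι → V
  dst : ι → V

namespace Graph

variable {V ι : Type*} (G : Graph V ι)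

/-- A step along an open edge with both endpoints in `S`. -/
def Step (ω : ι → Bool) (S : Set V) (a b : V) : Prop :=
  ∃ e, G.src e = a ∧ G.dst e = b ∧ ω e = true ∧ a ∈ S ∧ b ∈ S

/-- There is an open path from `a` to `b` in `S`. -/
def Conn (ω : ι → Bool) (S : Set V) : V → V → Prop :=
  Relation.ReflTransGen (G.Step ω S)

/-- The event that there is an open path from `a` to `b` in `S`. -/
def connEvent (S : Set V) (a b : V) : Set (ι → Bool) := {ω | G.Conn ω S a b}

/-- The event that there is an open path in `S` from `a` to the complement of `D`. -/
def exitEvent (S D : Set V) (a : V) : Set (ι → Bool) := {ω | ∃ b ∉ D, G.Conn ω S a b}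

variable {G}

lemma Conn.mono {ω ω' : ι → Bool} {S S' : Set V} {a b : V} (hω : ∀ e, ω e = true → ω' e = true)
    (hS : S ⊆ S') (h : G.Conn ω S a b) : G.Conn ω' S' a b :=
  Relation.ReflTransGen.mono
    (fun _ _ ⟨e, h₁, h₂, h₃, h₄, h₅⟩ => ⟨e, h₁, h₂, hω e h₃, hS h₄, hS h₅⟩) _ _ h

lemma Conn.mem {ω : ι → Bool} {S : Set V} {a b : V} (h : G.Conn ω S a b) (ha : a ∈ S) :
    b ∈ S := by
  induction h with
  | refl => exact ha
  | tail _ h _ =>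
    obtain ⟨_, _, _, _, _, h⟩ := h
    exact h

variable (G)

lemma increasing_connEvent (S : Set V) (a b : V) : Increasing (G.connEvent S a b) :=
  fun _ _ hω h => Conn.mono hω subset_rfl h

lemma increasing_exitEvent (S D : Set V) (a : V) : Increasing (G.exitEvent S D a) :=
  fun _ _ hω ⟨b, hb, h⟩ => ⟨b, hb, h.mono hω subset_rfl⟩

lemma determinedBy_connEvent (S : Set V) (a b : V) :
    DeterminedBy {e | G.src e ∈ S ∧ G.dst e ∈ S} (G.connEvent S a b) := by
  intro ω ω' h hab
  refine Relation.ReflTransGen.mono (fun x y => ?_) _ _ hab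
  rintro ⟨e, rfl, rfl, h₃, h₄, h₅⟩
  exact ⟨e, rfl, rfl, h e ⟨h₄, h₅⟩ ▸ h₃, h₄, h₅⟩

lemma determinedBy_exitEvent (S D : Set V) (a : V) :
    DeterminedBy {e | G.src e ∈ S ∧ G.dst e ∈ S} (G.exitEvent S D a) :=
  fun ω ω' h ⟨b, hb, hab⟩ => ⟨b, hb, G.determinedBy_connEvent S a b ω ω' h hab⟩

/-- Leaving `D` only involves edges issued from `D`. -/
lemma determinedBy_exitEvent_univ (D : Set V) (a : V) :
    DeterminedBy {e | G.src e ∈ D} (G.exitEvent Set.univ D a) := by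
  rintro ω ω' h ⟨b, hb, hab⟩
  induction hab using Relation.ReflTransGen.head_induction_on with
  | refl => exact ⟨b, hb, .refl⟩
  | @head x y hxy _ ih =>
    obtain ⟨c, hc, hyc⟩ := ih
    obtain ⟨e, rfl, rfl, h₃, -, -⟩ := hxy
    by_cases hx : G.src e ∈ D
    · exact ⟨c, hc, .head ⟨e, rfl, rfl, h e hx ▸ h₃, trivial, trivial⟩ hyc⟩
    · exact ⟨_, hx, .refl⟩

variable [Countable ι]

lemma measurableSet_step [Countable V] (S : Set V) (a b : V) :
    MeasurableSet {ω : ι → Bool | G.Step ω S a b} := by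
  have : {ω : ι → Bool | G.Step ω S a b} = ⋃ e : ι, ⋃ _ : G.src e = a ∧ G.dst e = b ∧ a ∈ S ∧ b ∈ S,
      {ω | ω e = true} := by
    ext ω
    simp only [Step, Set.mem_ofPred_eq, Set.mem_iUnion, exists_prop]
    exact exists_congr fun e => by tauto
  rw [this]
  exact MeasurableSet.iUnion fun e => MeasurableSet.iUnion fun _ =>
    measurableSet_eval_true e

lemma measurableSet_connEvent [Countable V] (S : Set V) (a b : V) :
    MeasurableSet (G.connEvent S a b) := by
  classical
  let R : ℕ → V → Set (ι → Bool) := fun n => Nat.rec (fun b => {_ω | a = b})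
    (fun _ R b => ⋃ c, R c ∩ {ω | G.Step ω S c b}) n
  have hR (n : ℕ) : ∀ b, MeasurableSet (R n b) := by
    induction n with
    | zero => exact fun b => MeasurableSet.const _
    | succ n ih =>
      exact fun b => MeasurableSet.iUnion fun c => (ih c).inter (G.measurableSet_step S c b)
  have : G.connEvent S a b = ⋃ n, R n b := by
    ext ω
    rw [Set.mem_iUnion]
    constructor
    · intro h
      induction (show G.Conn ω S a b from h) with
      | refl => exact ⟨0, rfl⟩
      | @tail c d h₁ h₂ ih =>
        obtain ⟨n, hn⟩ := ih h₁
        exact ⟨n + 1, Set.mem_iUnion.2 ⟨c, hn, h₂⟩⟩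
    · rintro ⟨n, hn⟩
      induction n generalizing b with
      | zero =>
        have : a = b := hn
        exact this ▸ Relation.ReflTransGen.refl
      | succ n ih =>
        obtain ⟨c, h₁, h₂⟩ := Set.mem_iUnion.1 hn
        exact Relation.ReflTransGen.tail (ih c h₁) h₂
  rw [this]
  exact MeasurableSet.iUnion fun n => hR n b

lemma measurableSet_exitEvent [Countable V] (S D : Set V) (a : V) :
    MeasurableSet (G.exitEvent S D a) := by
  have : G.exitEvent S D a = ⋃ b, ⋃ _ : b ∉ D, G.connEvent S a b := by
    ext ω
    simp [exitEvent, connEvent]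
  rw [this]
  exact MeasurableSet.iUnion fun b => MeasurableSet.iUnion fun _ =>
    G.measurableSet_connEvent S a b

end Graph

end Graph

section Inequalities

namespace Graph

variable {V ι : Type*} (G : Graph V ι)

/-- The event that the cluster of `o` in `S` is exactly `C`. -/
def clusterEvent (S : Set V) (o : V) (C : Set V) : Set (ι → Bool) :=
  {ω | ∀ z, G.Conn ω S o z ↔ z ∈ C}

/-- The event that `S` is the set of vertices from which the complement of `D` cannot be
reached. -/
def trapEvent (D S : Set V) : Set (ι → Bool) :=
  {ω | ∀ z, ω ∈ G.exitEvent Set.univ D z ↔ z ∉ S}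

lemma determinedBy_clusterEvent {S : Set V} {o : V} (C : Set V) :
    DeterminedBy {e | G.src e ∈ C ∧ G.dst e ∈ S} (G.clusterEvent S o C) := by
  intro ω ω' h hω z
  constructor
  · intro hz
    induction hz with
    | refl => exact (hω o).1 .refl
    | tail _ hab ih =>
      obtain ⟨e, rfl, rfl, h₃, h₄, h₅⟩ := hab
      exact (hω _).1 (.tail ((hω _).2 ih) ⟨e, rfl, rfl, (h e ⟨ih, h₅⟩).trans h₃, h₄, h₅⟩)
  · intro hz
    have hz' := (hω z).2 hz
    clear hz
    induction hz' with
    | refl => exact .refl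
    | tail ha hab ih =>
      obtain ⟨e, rfl, rfl, h₃, h₄, h₅⟩ := hab
      exact .tail ih ⟨e, rfl, rfl, (h e ⟨(hω _).1 ha, h₅⟩).symm.trans h₃, h₄, h₅⟩

lemma determinedBy_trapEvent (D S : Set V) :
    DeterminedBy {e | G.dst e ∉ S} (G.trapEvent D S) := by
  intro ω ω' h hω z
  constructor
  · rintro ⟨b, hb, hzb⟩
    induction hzb using Relation.ReflTransGen.head_induction_on with
    | refl => exact (hω b).1 ⟨b, hb, .refl⟩
    | head hab _ ih =>
      obtain ⟨e, rfl, rfl, h₃, h₄, h₅⟩ := hab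
      obtain ⟨c, hc, hbc⟩ := (hω _).2 ih
      exact (hω _).1 ⟨c, hc, .head ⟨e, rfl, rfl, (h e ih).trans h₃, h₄, h₅⟩ hbc⟩
  · intro hz
    obtain ⟨b, hb, hzb⟩ := (hω z).2 hz
    refine ⟨b, hb, ?_⟩
    clear hz
    induction hzb using Relation.ReflTransGen.head_induction_on with
    | refl => exact .refl
    | head hab hbc ih =>
      obtain ⟨e, rfl, rfl, h₃, h₄, h₅⟩ := hab
      exact .head ⟨e, rfl, rfl, (h e ((hω _).1 ⟨b, hb, hbc⟩)).symm.trans h₃, h₄, h₅⟩ ih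

variable [Countable V] [Countable ι]

lemma measurableSet_clusterEvent (S : Set V) (o : V) (C : Set V) :
    MeasurableSet (G.clusterEvent S o C) := by
  have : G.clusterEvent S o C = ⋂ z, {ω | ω ∈ G.connEvent S o z ↔ z ∈ C} := by
    ext ω
    simp [clusterEvent, connEvent]
  rw [this]
  refine MeasurableSet.iInter fun z => ?_
  by_cases hz : z ∈ C
  · simpa [hz] using G.measurableSet_connEvent S o z
  · simp only [hz, iff_false]
    exact (G.measurableSet_connEvent S o z).compl

lemma measurableSet_trapEvent (D S : Set V) : MeasurableSet (G.trapEvent D S) := by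
  have : G.trapEvent D S = ⋂ z, {ω | ω ∈ G.exitEvent Set.univ D z ↔ z ∉ S} := by
    ext ω
    simp [trapEvent]
  rw [this]
  refine MeasurableSet.iInter fun z => ?_
  by_cases hz : z ∈ S
  · simp only [hz, not_true, iff_false]
    exact (G.measurableSet_exitEvent Set.univ D z).compl
  · simpa [hz] using G.measurableSet_exitEvent Set.univ D z

/-- A path leaving `D ⊇ S` from `o ∈ S` leaves the cluster of `o` in `S` for the last time
through an edge of the boundary of `S`, and then avoids that cluster. -/
lemma bernPi_real_exitEvent_le {q : ι → ℝ} (hq : ∀ e, q e ∈ Set.Icc (0 : ℝ) 1) {S : Finset V}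
    {D : Set V} (hSD : (S : Set V) ⊆ D) {o : V} (ho : o ∈ S) (B : Finset ι)
    (hB : ∀ e, e ∈ B ↔ G.src e ∈ S ∧ G.dst e ∉ S) :
    (bernPi q).real (G.exitEvent Set.univ D o) ≤
      ∑ e ∈ B, q e * (bernPi q).real (G.connEvent S o (G.src e)) *
        (bernPi q).real (G.exitEvent Set.univ D (G.dst e)) := by
  classical
  let piece (e : ι) (C : Finset V) : Set (ι → Bool) :=
    (G.clusterEvent S o C ∩ {ω | ω e = true}) ∩ G.exitEvent (C : Set V)ᶜ D (G.dst e)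
  have hcover : G.exitEvent Set.univ D o ⊆
      ⋃ e ∈ B, ⋃ C ∈ S.powerset.filter (G.src e ∈ ·), piece e C := by
    rintro ω ⟨b, hb, hob⟩
    set C := S.filter (G.Conn ω S o) with hC
    have hcl : ω ∈ G.clusterEvent S o C := by
      intro z
      simp only [hC, Finset.coe_filter, Set.mem_ofPred_eq]
      exact ⟨fun h => ⟨h.mem ho, h⟩, fun h => h.2⟩
    have key : b ∈ C ∨ ∃ e ∈ B, G.src e ∈ C ∧ ω e = true ∧
        G.Conn ω (C : Set V)ᶜ (G.dst e) b := by
      clear hb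
      induction hob with
      | refl => exact Or.inl (Finset.mem_filter.2 ⟨ho, .refl⟩)
      | @tail x y _ hxy ih =>
        by_cases hy : y ∈ C
        · exact Or.inl hy
        right
        by_cases hx : x ∈ C
        · obtain ⟨e, rfl, rfl, h₃, -, -⟩ := hxy
          have hxS := (Finset.mem_filter.1 hx)
          refine ⟨e, (hB e).2 ⟨hxS.1, fun hyS => hy ?_⟩, hx, h₃, .refl⟩
          exact Finset.mem_filter.2 ⟨hyS, hxS.2.tail ⟨e, rfl, rfl, h₃, hxS.1, hyS⟩⟩
        · obtain ⟨e, heB, heC, he, hconn⟩ := ih.resolve_left hx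
          obtain ⟨f, rfl, rfl, h₃, -, -⟩ := hxy
          exact ⟨e, heB, heC, he, hconn.tail ⟨f, rfl, rfl, h₃, by simpa using hx,
            by simpa using hy⟩⟩
    have hbC : b ∉ C := fun h => hb (hSD (Finset.mem_filter.1 h).1)
    obtain ⟨e, heB, heC, he, hconn⟩ := key.resolve_left hbC
    simp only [Set.mem_iUnion]
    exact ⟨e, heB, C, Finset.mem_filter.2
      ⟨Finset.mem_powerset.2 (Finset.filter_subset _ _), heC⟩, ⟨hcl, he⟩, b, hb, hconn⟩
  have hpiece (e : ι) (heB : e ∈ B) (C : Finset V)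
      (hC : C ∈ S.powerset.filter (G.src e ∈ ·)) : (bernPi q).real (piece e C) ≤
        (bernPi q).real (G.clusterEvent S o C) *
          (q e * (bernPi q).real (G.exitEvent Set.univ D (G.dst e))) := by
    have he := (hB e).1 heB
    have heC := (Finset.mem_filter.1 hC).2
    have hdet : DeterminedBy {f | f = e} {ω : ι → Bool | ω e = true} :=
      fun ω ω' h hω => (h e rfl).symm.trans hω
    rw [bernPi_real_inter (I := {f | G.src f ∈ C ∧ G.dst f ∈ S} ∪ {f | f = e})
        (J := {f | G.src f ∉ C}) ?_ ((G.measurableSet_clusterEvent _ _ _).inter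
          (measurableSet_eval_true e)) (G.measurableSet_exitEvent _ _ _)
        ((G.determinedBy_clusterEvent _).inter hdet)
        ((G.determinedBy_exitEvent _ _ _).mono fun f hf => hf.1),
      bernPi_real_inter ?_ (G.measurableSet_clusterEvent _ _ _) (measurableSet_eval_true e)
        (G.determinedBy_clusterEvent _) hdet, bernPi_real_eval e (hq e).1 (hq e).2, mul_assoc]
    · refine mul_le_mul_of_nonneg_left (mul_le_mul_of_nonneg_left ?_ (hq e).1)
        measureReal_nonneg
      exact measureReal_mono fun ω ⟨b, hb, h⟩ => ⟨b, hb, h.mono (fun _ h => h) (Set.subset_univ _)⟩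
    · rw [Set.disjoint_left]
      rintro f hf rfl
      exact he.2 hf.2
    · rw [Set.disjoint_left]
      rintro f (hf | rfl) hf'
      · exact hf' hf.1
      · exact hf' heC
  have hcluster (e : ι) : ∑ C ∈ S.powerset.filter (G.src e ∈ ·),
      (bernPi q).real (G.clusterEvent S o C) ≤
        (bernPi q).real (G.connEvent S o (G.src e)) := by
    rw [← measureReal_biUnion_finset]
    · refine measureReal_mono (Set.iUnion₂_subset fun C hC ω hω => ?_)
      exact (hω _).2 (Finset.mem_filter.1 hC).2
    · intro C _ C' _ hne
      refine Set.disjoint_left.2 fun ω hω hω' => hne ?_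
      ext z
      exact (hω z).symm.trans (hω' z)
    · exact fun C _ => G.measurableSet_clusterEvent _ _ _
  calc (bernPi q).real (G.exitEvent Set.univ D o)
      ≤ (bernPi q).real (⋃ e ∈ B, ⋃ C ∈ S.powerset.filter (G.src e ∈ ·), piece e C) :=
        measureReal_mono hcover (measure_ne_top _ _)
    _ ≤ ∑ e ∈ B, ∑ C ∈ S.powerset.filter (G.src e ∈ ·), (bernPi q).real (piece e C) :=
        (measureReal_biUnion_finset_le _ _).trans
          (Finset.sum_le_sum fun e _ => measureReal_biUnion_finset_le _ _)
    _ ≤ ∑ e ∈ B, ∑ C ∈ S.powerset.filter (G.src e ∈ ·), (bernPi q).real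
          (G.clusterEvent S o C) * (q e * (bernPi q).real (G.exitEvent Set.univ D (G.dst e))) :=
        Finset.sum_le_sum fun e he => Finset.sum_le_sum fun C hC => hpiece e he C hC
    _ ≤ _ := by
        refine Finset.sum_le_sum fun e _ => ?_
        rw [← Finset.sum_mul, mul_comm (q e) ((bernPi q).real (G.connEvent _ _ _)), mul_assoc]
        exact mul_le_mul_of_nonneg_right (hcluster e)
          (mul_nonneg (hq e).1 measureReal_nonneg)

/-- The pivotal edges for leaving `D` from `o`, when all sets in `D` containing `o` have a large
expected number of boundary edges reachable from inside. -/
lemma compl_exitEvent_le_sum_force [DecidableEq ι] (q : ι → ℝ) {D : Finset V} {o : V}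
    (F : Finset ι)
    (hφ : ∀ S ⊆ D, o ∈ S → ∀ B : Finset ι, (∀ e, e ∈ B ↔ e ∈ F ∧ G.src e ∈ S ∧ G.dst e ∉ S) →
      1 ≤ ∑ e ∈ B, (bernPi q).real (G.connEvent S o (G.src e))) :
    1 - (bernPi q).real (G.exitEvent Set.univ D o) ≤
      ∑ e ∈ F, ((bernPi q).real (force e true (G.exitEvent Set.univ D o)) -
        (bernPi q).real (force e false (G.exitEvent Set.univ D o))) := by
  classical
  set A := G.exitEvent Set.univ (D : Set V) o with hAdef
  have hA : MeasurableSet A := G.measurableSet_exitEvent _ _ _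
  have hinc : Increasing A := G.increasing_exitEvent _ _ _
  let 𝒮 := D.powerset.filter (o ∈ ·)
  let B (S : Finset V) := F.filter fun e => G.src e ∈ S ∧ G.dst e ∉ S
  have hdisj : Pairwise fun S S' : Finset V =>
      Disjoint (G.trapEvent (D : Set V) S) (G.trapEvent D S') := by
    intro S S' hne
    refine Set.disjoint_left.2 fun ω hω hω' => hne ?_
    ext z
    exact not_iff_not.1 ((hω z).symm.trans (hω' z))
  have htotal : 1 - (bernPi q).real A ≤ ∑ S ∈ 𝒮, (bernPi q).real (G.trapEvent D S) := by
    rw [← probReal_compl_eq_one_sub hA]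
    refine (measureReal_mono ?_ (measure_ne_top _ _)).trans
      (measureReal_biUnion_finset_le 𝒮 _)
    intro ω hω
    simp only [Set.mem_iUnion]
    refine ⟨D.filter fun z => ω ∉ G.exitEvent Set.univ D z, ?_, ?_⟩
    · refine Finset.mem_filter.2 ⟨Finset.mem_powerset.2 (Finset.filter_subset _ _), ?_⟩
      refine Finset.mem_filter.2 ⟨by_contra fun ho => hω ⟨o, ho, .refl⟩, hω⟩
    · intro z
      simp only [Finset.coe_filter, Set.mem_ofPred_eq, not_and, not_not]
      exact ⟨fun h _ => h, fun h => by_contra fun hz => hz (h (by_contra fun hD =>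
        hz ⟨z, hD, .refl⟩))⟩
  have hpiv (e : ι) : ∑ S ∈ 𝒮.filter (fun S => e ∈ B S), (bernPi q).real
      (G.trapEvent D S ∩ G.connEvent S o (G.src e)) ≤
      (bernPi q).real (force e true A) - (bernPi q).real (force e false A) := by
    rw [← measureReal_biUnion_finset, ← measureReal_sdiff
      ((hinc.force_false_subset e).trans (hinc.subset_force_true e))
      (measurableSet_force hA e false)]
    · refine measureReal_mono (Set.iUnion₂_subset fun S hS ω hω => ?_)
      obtain ⟨hS, he⟩ := Finset.mem_filter.1 hS
      have he := (Finset.mem_filter.1 he).2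
      have hωA : ω ∉ A := fun h => (hω.1 o).1 h (Finset.mem_filter.1 hS).2
      refine ⟨?_, fun h => hωA (hinc.force_false_subset e h)⟩
      have hup : ∀ f, ω f = true → Function.update ω e true f = true := by
        intro f hf
        by_cases hfe : f = e
        · simp [hfe]
        · simpa [hfe] using hf
      obtain ⟨b, hb, hconn⟩ := (hω.1 (G.dst e)).2 he.2
      exact ⟨b, hb, ((hω.2.mono hup (Set.subset_univ _)).tail
        ⟨e, rfl, rfl, by simp, trivial, trivial⟩).trans (hconn.mono hup subset_rfl)⟩
    · exact fun S _ S' _ hne => (hdisj hne).mono Set.inter_subset_left Set.inter_subset_left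
    · exact fun S _ => (G.measurableSet_trapEvent _ _).inter (G.measurableSet_connEvent _ _ _)
  calc 1 - (bernPi q).real A
      ≤ ∑ S ∈ 𝒮, (bernPi q).real (G.trapEvent D S) := htotal
    _ ≤ ∑ S ∈ 𝒮, ∑ e ∈ B S, (bernPi q).real (G.trapEvent D S ∩ G.connEvent S o (G.src e)) := by
        refine Finset.sum_le_sum fun S hS => ?_
        obtain ⟨hSD, ho⟩ := Finset.mem_filter.1 hS
        have hprod (e : ι) : (bernPi q).real (G.trapEvent D S ∩ G.connEvent S o (G.src e)) =
            (bernPi q).real (G.trapEvent D S) * (bernPi q).real (G.connEvent S o (G.src e)) :=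
          bernPi_real_inter
            (Set.disjoint_left.2 fun e (he : G.dst e ∉ (S : Set V)) he' => he he'.2)
            (G.measurableSet_trapEvent _ _) (G.measurableSet_connEvent _ _ _)
            (G.determinedBy_trapEvent _ _) (G.determinedBy_connEvent _ _ _)
        simp only [hprod, ← Finset.mul_sum]
        exact le_mul_of_one_le_right measureReal_nonneg
          (hφ S (Finset.mem_powerset.1 hSD) ho (B S) fun e => by simp [B])
    _ = ∑ e ∈ F, ∑ S ∈ 𝒮.filter (fun S => e ∈ B S),
          (bernPi q).real (G.trapEvent D S ∩ G.connEvent S o (G.src e)) := by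
        refine Finset.sum_comm' fun S e => ?_
        simp only [Finset.mem_filter, B]
        tauto
    _ ≤ _ := Finset.sum_le_sum fun e _ => hpiv e

/-- If all sets in `D` containing `o` have an expected number at least `1` of boundary edges
reachable from inside, then raising all parameters by `δ` makes the probability of leaving `D`
bounded below. -/
theorem one_sub_exp_le_bernPi_real_exitEvent {q : ι → ℝ} {δ : ℝ} (hδ : 0 ≤ δ)
    (hq : ∀ t ∈ Set.Icc (0 : ℝ) 1, ∀ e, q e + t * δ ∈ Set.Icc (0 : ℝ) 1) {D : Finset V} {o : V}
    (F : Finset ι) (hF : ∀ e, G.src e ∈ D → e ∈ F)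
    (hφ : ∀ S ⊆ D, o ∈ S → ∀ B : Finset ι, (∀ e, e ∈ B ↔ G.src e ∈ S ∧ G.dst e ∉ S) →
      1 ≤ ∑ e ∈ B, (bernPi q).real (G.connEvent S o (G.src e))) :
    1 - Real.exp (-δ) ≤ (bernPi fun e => q e + δ).real (G.exitEvent Set.univ D o) := by
  classical
  set A := G.exitEvent Set.univ (D : Set V) o with hAdef
  set θ : ℝ → ℝ := fun s => (bernPi fun e => q e + s * δ).real A with hθ
  have hA : MeasurableSet A := G.measurableSet_exitEvent _ _ _
  have hdet : DeterminedBy (F : Set ι) A := (G.determinedBy_exitEvent_univ D o).mono hF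
  have hd := fun s hs => hasDerivWithinAt_bernPi_real hq F hA hdet (t := s) hs
  have hexp (s : ℝ) : HasDerivAt (fun s => Real.exp (s * δ)) (Real.exp (s * δ) * δ) s := by
    simpa using ((hasDerivAt_id s).mul_const δ).exp
  have hanti := antitoneOn_of_hasDerivWithinAt_nonpos (convex_Icc (0 : ℝ) 1)
    (f := fun s => (1 - θ s) * Real.exp (s * δ))
    (fun s hs => (((hd s hs).const_sub 1).mul (hexp s).hasDerivWithinAt).continuousWithinAt)
    (fun s hs => (((hd s (interior_subset hs)).const_sub 1).mul
      (hexp s).hasDerivWithinAt).mono interior_subset)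
    (fun s hs => by
      have hs' := interior_subset hs
      have hle := G.compl_exitEvent_le_sum_force (fun e => q e + s * δ) (D := D) (o := o) F
        fun S hSD ho B hB => by
          have hB' : ∀ e, e ∈ B ↔ G.src e ∈ S ∧ G.dst e ∉ S := fun e =>
            (hB e).trans ⟨fun h => h.2, fun h => ⟨hF e (hSD h.1), h⟩⟩
          refine (hφ S hSD ho B hB').trans (Finset.sum_le_sum fun e _ => ?_)
          exact bernPi_real_mono hδ hq F (G.measurableSet_connEvent _ _ _)
            ((G.determinedBy_connEvent _ _ _).mono fun f hf => hF f (hSD hf.1))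
            (G.increasing_connEvent _ _ _) hs'
      have hle := mul_le_mul_of_nonneg_left hle hδ
      have := mul_le_mul_of_nonneg_right hle (Real.exp_pos (s * δ)).le
      linarith)
  have h01 := hanti (Set.left_mem_Icc.2 zero_le_one) (Set.right_mem_Icc.2 zero_le_one) zero_le_one
  simp only [one_mul, zero_mul, Real.exp_zero, mul_one] at h01
  have hθ0 : 0 ≤ θ 0 := measureReal_nonneg
  have hθ1 : θ 1 = (bernPi fun e => q e + δ).real A := by simp [hθ]
  have hpos := Real.exp_pos δ
  rw [← hθ1, Real.exp_neg]
  have : (1 - θ 1) ≤ (Real.exp δ)⁻¹ := by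
    rw [← one_div, le_div_iff₀ hpos]
    linarith
  linarith

end Graph

end Inequalities

section Lattice

open Measure

/-- The endpoint of the lattice edge issued from `v` in the positive direction, horizontally if
`hor` is `true` and vertically otherwise. -/
def shift (hor : Bool) (v : ℤ × ℤ) : ℤ × ℤ := if hor then (v.1 + 1, v.2) else (v.1, v.2 + 1)

/-- The square lattice: `(v, hor, fwd)` is the edge between `v` and `shift hor v`, directed
positively if `fwd` is `true` and negatively otherwise. -/
def sq : Graph (ℤ × ℤ) ((ℤ × ℤ) × Bool × Bool) where
  src e := if e.2.2 then e.1 else shift e.2.1 e.1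
  dst e := if e.2.2 then shift e.2.1 e.1 else e.1

/-- The box of radius `n` centred at the origin. -/
noncomputable def box (n : ℕ) : Finset (ℤ × ℤ) := Finset.Icc (-n, -n) (n, n)

lemma mem_box {n : ℕ} {v : ℤ × ℤ} : v ∈ box n ↔ (-n ≤ v.1 ∧ -n ≤ v.2) ∧ v.1 ≤ n ∧ v.2 ≤ n := by
  simp [box, Prod.le_def]

/-- The probability that the origin is connected to the outside of the box of radius `n`. -/
noncomputable def exitProb (q : (ℤ × ℤ) × Bool × Bool → ℝ) (n : ℕ) : ℝ :=
  (bernPi q).real (sq.exitEvent Set.univ (box n) 0)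

lemma bernPi_map_comp {ι : Type*} (q : ι → ℝ) {τ : ι → ι} (hτ : Function.Injective τ) :
    (bernPi q).map (fun ω e => ω (τ e)) = bernPi fun e => q (τ e) :=
  map_infinitePi_infinitePi_of_inj hτ

lemma bern_map_not {q : ℝ} (h₀ : 0 ≤ q) (h₁ : q ≤ 1) : (bern q).map (! ·) = bern (1 - q) := by
  ext B hB
  rw [map_apply (measurable_of_countable _) hB, bern_apply h₀ h₁,
    bern_apply (by linarith) (by linarith), show 1 - (1 - q) = q by ring, add_comm]
  rfl

lemma bernPi_map_not_comp {ι : Type*} {q : ι → ℝ} (hq : ∀ e, q e ∈ Set.Icc (0 : ℝ) 1) {τ : ι → ι}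
    (hτ : Function.Injective τ) :
    (bernPi q).map (fun ω e => !ω (τ e)) = bernPi fun e => 1 - q (τ e) := by
  have h : (fun (ω : ι → Bool) e => !ω (τ e)) =
      (fun (ω : ι → Bool) e => !ω e) ∘ fun ω e => ω (τ e) := rfl
  rw [h, ← map_map, bernPi_map_comp q hτ, bernPi, infinitePi_map_pi]
  · simp only [bern_map_not (hq _).1 (hq _).2]
    rfl
  · exact fun _ => measurable_of_countable _
  · exact measurable_pi_lambda _ fun e => (measurable_of_countable (! ·)).comp
      (measurable_pi_apply e)
  · exact measurable_pi_lambda _ fun e => measurable_pi_apply _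

/-- Parameters that depend only on the direction of the edge. -/
def dirParam (f : Bool → Bool → ℝ) : (ℤ × ℤ) × Bool × Bool → ℝ := fun e => f e.2.1 e.2.2

lemma bernPi_real_exitEvent_le_exitProb (f : Bool → Bool → ℝ) {D : Set (ℤ × ℤ)} {y : ℤ × ℤ}
    {m : ℕ} (h : ∀ b ∉ D, b - y ∉ box m) :
    (bernPi (dirParam f)).real (sq.exitEvent Set.univ D y) ≤ exitProb (dirParam f) m := by
  let τ : (ℤ × ℤ) × Bool × Bool → (ℤ × ℤ) × Bool × Bool := fun e => (e.1 + y, e.2)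
  have hτ : Function.Injective τ := by
    rintro ⟨a, b⟩ ⟨c, d⟩ h
    simpa [τ] using h
  have hmap := bernPi_map_comp (dirParam f) hτ
  have hm : Measurable fun (ω : (ℤ × ℤ) × Bool × Bool → Bool) e => ω (τ e) :=
    measurable_pi_lambda _ fun e => measurable_pi_apply _
  have hparam : (fun e => dirParam f (τ e)) = dirParam f := rfl
  rw [hparam] at hmap
  have hE : exitProb (dirParam f) m = (bernPi (dirParam f)).real
      ((fun ω e => ω (τ e)) ⁻¹' sq.exitEvent Set.univ (box m) 0) := by
    rw [← map_measureReal_apply hm (sq.measurableSet_exitEvent _ _ _), hmap, exitProb]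
  rw [hE]
  refine measureReal_mono ?_ (measure_ne_top _ _)
  rintro ω ⟨b, hb, hconn⟩
  refine ⟨b - y, by simpa using h b hb, ?_⟩
  have := Relation.ReflTransGen.lift (p := sq.Step (fun e => ω (τ e)) Set.univ) (fun v => v - y)
    (fun a c hac => ?_) _ _ hconn
  · simpa [Graph.Conn, Function.onFun] using this
  · obtain ⟨⟨v, hor, fwd⟩, rfl, rfl, h₃, -, -⟩ := hac
    refine ⟨(v - y, hor, fwd), ?_, ?_, by simpa [τ] using h₃, trivial, trivial⟩ <;>
    cases hor <;> cases fwd <;> ext <;> simp [sq, shift] <;> ring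

lemma sum_range_mul_sub_succ (a b : ℕ → ℤ) (n : ℕ) :
    ∑ j ∈ Finset.range (n + 1), a j * (b j - b (j + 1)) =
      a 0 * b 0 - a n * b (n + 1) + ∑ j ∈ Finset.range n, (a (j + 1) - a j) * b (j + 1) := by
  induction n with
  | zero => simp; ring
  | succ n ih =>
    rw [Finset.sum_range_succ, ih, Finset.sum_range_succ _ n]
    ring

lemma sum_range_succ_mul_sub (a b : ℕ → ℤ) (k : ℕ) :
    ∑ i ∈ Finset.range k, a (i + 1) * (b i - b (i + 1)) =
      a 0 * b 0 - a (k + 1) * b k + ∑ i ∈ Finset.range (k + 1), (a (i + 1) - a i) * b i := by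
  induction k with
  | zero => simp; ring
  | succ k ih =>
    rw [Finset.sum_range_succ, ih, Finset.sum_range_succ _ (k + 1)]
    ring

/-- Planar duality: in a rectangle whose left side lies in `R` and whose right side avoids `R`,
the interface of `R`, directed with `R` on its left, connects the bottom to the top. The face
between the columns `i, i + 1` and the rows `j - 1, j` has coordinates `(i, j)`. -/
lemma interface_crossing {k n : ℕ} {R D : ℕ → ℕ → Prop} (hleft : ∀ j ≤ n, R 0 j)
    (hright : ∀ j ≤ n, ¬R (k + 1) j) (hbot : ∀ i ≤ k, D i 0)
    (hup : ∀ i j, R i j → ¬R (i + 1) j → D i j → D i (j + 1))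
    (hdown : ∀ i j, ¬R i j → R (i + 1) j → D i (j + 1) → D i j)
    (hrt : ∀ i j, R (i + 1) (j + 1) → ¬R (i + 1) j → D i (j + 1) → D (i + 1) (j + 1))
    (hlt : ∀ i j, ¬R (i + 1) (j + 1) → R (i + 1) j → D (i + 1) (j + 1) → D i (j + 1)) :
    ∃ i ≤ k, D i (n + 1) := by
  classical
  by_contra! htop
  let h : ℕ → ℕ → ℤ := fun i j => if R i j then 1 else 0
  let d : ℕ → ℕ → ℤ := fun i j => if D i j then 1 else 0
  have h₁ : ∑ i ∈ Finset.range (k + 1), ∑ j ∈ Finset.range (n + 1),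
      (h i j - h (i + 1) j) * (d i j - d i (j + 1)) ≤ 0 := by
    refine Finset.sum_nonpos fun i _ => Finset.sum_nonpos fun j _ => ?_
    have := hup i j
    have := hdown i j
    by_cases R i j <;> by_cases R (i + 1) j <;> by_cases D i j <;> by_cases D i (j + 1) <;>
      simp_all [h, d]
  have h₂ : ∑ j ∈ Finset.range n, ∑ i ∈ Finset.range k,
      (h (i + 1) (j + 1) - h (i + 1) j) * (d i (j + 1) - d (i + 1) (j + 1)) ≤ 0 := by
    refine Finset.sum_nonpos fun j _ => Finset.sum_nonpos fun i _ => ?_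
    have := hrt i j
    have := hlt i j
    by_cases R (i + 1) (j + 1) <;> by_cases R (i + 1) j <;> by_cases D i (j + 1) <;>
      by_cases D (i + 1) (j + 1) <;> simp_all [h, d]
  have e₁ : ∑ i ∈ Finset.range (k + 1), ∑ j ∈ Finset.range (n + 1),
      (h i j - h (i + 1) j) * (d i j - d i (j + 1)) =
      1 + ∑ i ∈ Finset.range (k + 1), ∑ j ∈ Finset.range n,
        ((h i (j + 1) - h (i + 1) (j + 1)) - (h i j - h (i + 1) j)) * d i (j + 1) := by
    have hsum : ∑ i ∈ Finset.range (k + 1), (h i 0 - h (i + 1) 0) = 1 := by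
      rw [Finset.sum_range_sub']
      simp [h, hleft 0 (Nat.zero_le n), hright 0 (Nat.zero_le n)]
    rw [← hsum, ← Finset.sum_add_distrib]
    refine Finset.sum_congr rfl fun i hi => ?_
    have hi : i ≤ k := Nat.lt_succ_iff.1 (Finset.mem_range.1 hi)
    rw [sum_range_mul_sub_succ (fun j => h i j - h (i + 1) j) (d i) n]
    simp [d, hbot i hi, htop i hi]
  have e₂ : ∑ j ∈ Finset.range n, ∑ i ∈ Finset.range k,
      (h (i + 1) (j + 1) - h (i + 1) j) * (d i (j + 1) - d (i + 1) (j + 1)) =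
      ∑ j ∈ Finset.range n, ∑ i ∈ Finset.range (k + 1),
        ((h (i + 1) (j + 1) - h (i + 1) j) - (h i (j + 1) - h i j)) * d i (j + 1) := by
    refine Finset.sum_congr rfl fun j hj => ?_
    have hj : j < n := Finset.mem_range.1 hj
    rw [sum_range_succ_mul_sub (fun i => h i (j + 1) - h i j) (fun i => d i (j + 1)) k]
    simp [h, hleft j hj.le, hleft (j + 1) hj, hright j hj.le, hright (j + 1) hj]
  rw [Finset.sum_comm] at e₂
  have e₃ : ∑ i ∈ Finset.range (k + 1), ∑ j ∈ Finset.range n,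
        ((h i (j + 1) - h (i + 1) (j + 1)) - (h i j - h (i + 1) j)) * d i (j + 1) +
      ∑ j ∈ Finset.range n, ∑ i ∈ Finset.range (k + 1),
        ((h (i + 1) (j + 1) - h (i + 1) j) - (h i (j + 1) - h i j)) * d i (j + 1) = 0 := by
    rw [Finset.sum_comm, ← Finset.sum_add_distrib]
    refine Finset.sum_eq_zero fun j _ => ?_
    rw [← Finset.sum_add_distrib]
    refine Finset.sum_eq_zero fun i _ => ?_
    ring
  rw [Finset.sum_comm] at h₂
  linarith

/-- The edge of the square lattice crossed by a directed edge of the dual lattice, the latter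
being reflected in the horizontal axis. -/
def dualEdge (e : (ℤ × ℤ) × Bool × Bool) : (ℤ × ℤ) × Bool × Bool :=
  if e.2.1 then ((e.1.1 + 1, -e.1.2), false, !e.2.2) else ((e.1.1, -e.1.2), true, !e.2.2)

lemma dualEdge_injective : Function.Injective dualEdge := by
  rintro ⟨⟨a, b⟩, s, t⟩ ⟨⟨c, d⟩, s', t'⟩ h
  cases s <;> cases s' <;> simp_all [dualEdge]

/-- Either the left side of a square is connected to its right side, or the reflected dual
configuration has a connection between the images of the bottom and top sides. -/
lemma crossing_or_dual_crossing (ω : (ℤ × ℤ) × Bool × Bool → Bool) (n : ℕ) :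
    (∃ j ∈ Finset.range (n + 1), ω ∈ sq.exitEvent Set.univ
      {b | b - ((0 : ℤ), (j : ℤ)) ∈ box n} (0, j)) ∨
    ∃ i ∈ Finset.range (n + 1), (fun e => !ω (dualEdge e)) ∈ sq.exitEvent Set.univ
      {b | b - ((i : ℤ), (1 : ℤ)) ∈ box n} (i, 1) := by
  by_contra! hcon
  obtain ⟨hcon₁, hcon₂⟩ := hcon
  set ω' : (ℤ × ℤ) × Bool × Bool → Bool := fun e => !ω (dualEdge e) with hω'
  let R : ℤ × ℤ → Prop := fun v => ∃ j ≤ n, sq.Conn ω Set.univ (0, (j : ℤ)) v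
  let D : ℤ × ℤ → Prop := fun v => ∃ i ≤ n, sq.Conn ω' Set.univ ((i : ℤ), 1) v
  have hR {e : (ℤ × ℤ) × Bool × Bool} (h : R (sq.src e)) (h' : ¬R (sq.dst e)) :
      ω e = false := by
    by_contra he
    obtain ⟨j, hj, hconn⟩ := h
    exact h' ⟨j, hj, hconn.tail ⟨e, rfl, rfl, by simpa using he, trivial, trivial⟩⟩
  have hD (e : (ℤ × ℤ) × Bool × Bool) (he : ω (dualEdge e) = false) (h : D (sq.src e)) :
      D (sq.dst e) := by
    obtain ⟨i, hi, hconn⟩ := h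
    exact ⟨i, hi, hconn.tail ⟨e, rfl, rfl, by simp [hω', he], trivial, trivial⟩⟩
  obtain ⟨i, -, i', hi', hconn⟩ := interface_crossing (k := n) (n := n)
    (R := fun i j => R ((i : ℤ), (j : ℤ))) (D := fun i j => D ((i : ℤ), 1 - (j : ℤ)))
    (fun j hj => ⟨j, hj, .refl⟩)
    (fun j _ ⟨j', hj', hconn⟩ => hcon₁ j' (Finset.mem_range.2 (Nat.lt_succ_of_le hj'))
      ⟨_, by simp [mem_box], hconn⟩)
    (fun i hi => ⟨i, hi, by simp only [Nat.cast_zero, sub_zero]; exact .refl⟩)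
    (fun i j h₁ h₂ h₃ => by
      have := hD ((i, -j), false, false)
        (hR (by simpa [sq, dualEdge] using h₁) (by simpa [sq, dualEdge, shift] using h₂))
      simpa [sq, shift] using this (by simpa [sq, shift, sub_eq_neg_add] using h₃))
    (fun i j h₁ h₂ h₃ => by
      have := hD ((i, -j), false, true)
        (hR (by simpa [sq, dualEdge, shift] using h₂) (by simpa [sq, dualEdge, shift] using h₁))
      simpa [sq, shift, sub_eq_neg_add] using this (by simpa [sq, shift] using h₃))
    (fun i j h₁ h₂ h₃ => by
      have := hD ((i, -j), true, true)
        (hR (by simpa [sq, dualEdge, shift] using h₁) (by simpa [sq, dualEdge, shift] using h₂))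
      simpa [sq, shift] using this (by simpa [sq, shift] using h₃))
    (fun i j h₁ h₂ h₃ => by
      have := hD ((i, -j), true, false)
        (hR (by simpa [sq, dualEdge, shift] using h₂) (by simpa [sq, dualEdge, shift] using h₁))
      simpa [sq, shift] using this (by simpa [sq, shift] using h₃))
  exact hcon₂ i' (Finset.mem_range.2 (Nat.lt_succ_of_le hi')) ⟨_, by simp [mem_box], hconn⟩

end Lattice

section SelfDual

open Measure

lemma one_le_mul_exitProb {f : Bool → Bool → ℝ} (hf : ∀ a b, f a b ∈ Set.Icc (0 : ℝ) 1)
    (hdual : ∀ a b, 1 - f (!a) (!b) = f a b) (n : ℕ) :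
    1 ≤ 2 * (n + 1) * exitProb (dirParam f) n := by
  let Ψ : ((ℤ × ℤ) × Bool × Bool → Bool) → (ℤ × ℤ) × Bool × Bool → Bool :=
    fun ω e => !ω (dualEdge e)
  have hΨ : Measurable Ψ := measurable_pi_lambda _ fun e =>
    (measurable_of_countable (! ·)).comp (measurable_pi_apply _)
  have hparam : (fun e => 1 - dirParam f (dualEdge e)) = dirParam f := by
    funext ⟨v, a, b⟩
    rw [dirParam, dirParam, ← hdual a b]
    cases a <;> rfl
  have hmap : (bernPi (dirParam f)).map Ψ = bernPi (dirParam f) := by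
    exact (bernPi_map_not_comp (q := dirParam f) (fun e => hf _ _) dualEdge_injective).trans
      (by rw [hparam])
  let A : ℕ → Set ((ℤ × ℤ) × Bool × Bool → Bool) := fun j =>
    sq.exitEvent Set.univ {b | b - ((0 : ℤ), (j : ℤ)) ∈ box n} (0, j)
  let B : ℕ → Set ((ℤ × ℤ) × Bool × Bool → Bool) := fun i =>
    sq.exitEvent Set.univ {b | b - ((i : ℤ), (1 : ℤ)) ∈ box n} (i, 1)
  have hA (j : ℕ) : (bernPi (dirParam f)).real (A j) ≤ exitProb (dirParam f) n :=
    bernPi_real_exitEvent_le_exitProb f fun b hb => hb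
  have hB (i : ℕ) : (bernPi (dirParam f)).real (Ψ ⁻¹' B i) ≤ exitProb (dirParam f) n := by
    rw [← map_measureReal_apply hΨ (sq.measurableSet_exitEvent _ _ _), hmap]
    exact bernPi_real_exitEvent_le_exitProb f fun b hb => hb
  have hcover : (Set.univ : Set ((ℤ × ℤ) × Bool × Bool → Bool)) ⊆
      (⋃ j ∈ Finset.range (n + 1), A j) ∪ ⋃ i ∈ Finset.range (n + 1), Ψ ⁻¹' B i := by
    intro ω _
    rcases crossing_or_dual_crossing ω n with ⟨j, hj, h⟩ | ⟨i, hi, h⟩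
    · exact Or.inl (Set.mem_biUnion hj h)
    · exact Or.inr (Set.mem_biUnion hi h)
  calc (1 : ℝ) = (bernPi (dirParam f)).real Set.univ := by simp
    _ ≤ (bernPi (dirParam f)).real (⋃ j ∈ Finset.range (n + 1), A j) +
        (bernPi (dirParam f)).real (⋃ i ∈ Finset.range (n + 1), Ψ ⁻¹' B i) :=
      (measureReal_mono hcover (measure_ne_top _ _)).trans (measureReal_union_le _ _)
    _ ≤ ∑ j ∈ Finset.range (n + 1), exitProb (dirParam f) n +
        ∑ i ∈ Finset.range (n + 1), exitProb (dirParam f) n :=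
      add_le_add ((measureReal_biUnion_finset_le _ _).trans (Finset.sum_le_sum fun j _ => hA j))
        ((measureReal_biUnion_finset_le _ _).trans (Finset.sum_le_sum fun i _ => hB i))
    _ = 2 * (n + 1) * exitProb (dirParam f) n := by
      simp only [Finset.sum_const, Finset.card_range, nsmul_eq_mul]
      push_cast
      ring

lemma exists_subset_box (S : Finset (ℤ × ℤ)) : ∃ k, S ⊆ box k := by
  refine ⟨S.sup fun v => v.1.natAbs + v.2.natAbs, fun v hv => ?_⟩
  have := Finset.le_sup (f := fun v : ℤ × ℤ => v.1.natAbs + v.2.natAbs) hv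
  rw [mem_box]
  omega

lemma sub_notMem_box {e : (ℤ × ℤ) × Bool × Bool} {k m : ℕ} (he : sq.src e ∈ box k) {b : ℤ × ℤ}
    (hb : b ∉ box (m + (k + 1))) : b - sq.dst e ∉ box m := by
  obtain ⟨⟨x, y⟩, hor, fwd⟩ := e
  obtain ⟨b₁, b₂⟩ := b
  cases hor <;> cases fwd <;> simp [sq, shift, mem_box] at he hb ⊢ <;> omega

lemma box_mono {k m : ℕ} (h : k ≤ m) : box k ⊆ box m := by
  intro v
  simp only [mem_box]
  omega

/-- In a self-dual model, the expected number of boundary edges of a finite set whose source is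
reached from the origin inside the set is at least one. -/
lemma one_le_sum_connEvent {f : Bool → Bool → ℝ} (hf : ∀ a b, f a b ∈ Set.Icc (0 : ℝ) 1)
    (hdual : ∀ a b, 1 - f (!a) (!b) = f a b) {S : Finset (ℤ × ℤ)} (hS : 0 ∈ S)
    (B : Finset ((ℤ × ℤ) × Bool × Bool)) (hB : ∀ e, e ∈ B ↔ sq.src e ∈ S ∧ sq.dst e ∉ S) :
    1 ≤ ∑ e ∈ B, (bernPi (dirParam f)).real (sq.connEvent S 0 (sq.src e)) := by
  by_contra! hlt
  set φ := ∑ e ∈ B, (bernPi (dirParam f)).real (sq.connEvent S 0 (sq.src e)) with hφ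
  have hφ₀ : 0 ≤ φ := Finset.sum_nonneg fun _ _ => measureReal_nonneg
  obtain ⟨k, hk⟩ := exists_subset_box S
  have hstep (m : ℕ) : exitProb (dirParam f) (m + (k + 1)) ≤ φ * exitProb (dirParam f) m := by
    refine (sq.bernPi_real_exitEvent_le (q := dirParam f) (fun e => hf _ _)
      (fun v hv => box_mono (by omega) (hk hv)) hS B hB).trans ?_
    rw [hφ, Finset.sum_mul]
    refine Finset.sum_le_sum fun e he => ?_
    refine mul_le_mul ?_ ?_ measureReal_nonneg measureReal_nonneg
    · exact mul_le_of_le_one_left measureReal_nonneg (hf _ _).2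
    · exact bernPi_real_exitEvent_le_exitProb f
        fun b hb => sub_notMem_box (hk ((hB e).1 he).1) hb
  have hpow (m : ℕ) : exitProb (dirParam f) (m * (k + 1)) ≤ φ ^ m := by
    induction m with
    | zero => simp [exitProb]
    | succ m ih =>
      rw [Nat.succ_mul, pow_succ']
      exact (hstep _).trans (mul_le_mul_of_nonneg_left ih hφ₀)
  have hlow (m : ℕ) : 1 ≤ 2 * ((k + 1) * (m * φ ^ m)) + 2 * φ ^ m := by
    refine (one_le_mul_exitProb hf hdual (m * (k + 1))).trans ?_
    refine (mul_le_mul_of_nonneg_left (hpow m) (by positivity)).trans (le_of_eq ?_)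
    push_cast
    ring
  have hlim : Filter.Tendsto (fun m : ℕ => 2 * (((k : ℝ) + 1) * (m * φ ^ m)) + 2 * φ ^ m)
      Filter.atTop (nhds (2 * (((k : ℝ) + 1) * 0) + 2 * 0)) :=
    ((((tendsto_self_mul_const_pow_of_lt_one hφ₀ hlt).const_mul _).const_mul _)).add
      ((tendsto_pow_atTop_nhds_zero_of_lt_one hφ₀ hlt).const_mul _)
  have := ge_of_tendsto' hlim hlow
  norm_num at this

/-- Increasing all parameters of a self-dual model by `ε` makes it supercritical. -/
theorem one_sub_exp_le_exitProb {f : Bool → Bool → ℝ} {ε : ℝ} (hε : 0 ≤ ε)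
    (hf : ∀ a b, 0 ≤ f a b ∧ f a b + ε ≤ 1) (hdual : ∀ a b, 1 - f (!a) (!b) = f a b) (n : ℕ) :
    1 - Real.exp (-ε) ≤ exitProb (dirParam fun a b => f a b + ε) n := by
  refine sq.one_sub_exp_le_bernPi_real_exitEvent (q := dirParam f) hε ?_
    (F := box (n + 1) ×ˢ Finset.univ) ?_ ?_
  · rintro t ⟨ht₀, ht₁⟩ ⟨v, a, b⟩
    have := hf a b
    exact ⟨by simp only [dirParam]; nlinarith, by simp only [dirParam]; nlinarith⟩
  · rintro ⟨⟨x, y⟩, hor, fwd⟩ he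
    simp only [Finset.mem_product, Finset.mem_univ, and_true]
    cases hor <;> cases fwd <;> simp [sq, shift, mem_box] at he ⊢ <;> omega
  · intro S _ hS B hB
    exact one_le_sum_connEvent (fun a b => ⟨(hf a b).1, by linarith [(hf a b).2]⟩) hdual hS B hB

end SelfDual

section Coupling

open Measure

/-- Functions of disjoint blocks of independent variables are independent. -/
lemma infinitePi_map_blocks {ι κ J X Y : Type*} [MeasurableSpace X] [MeasurableSpace Y]
    (μ : ι → Measure X) [∀ i, IsProbabilityMeasure (μ i)] {τ : κ × J → ι}
    (hτ : Function.Injective τ) {g : κ → (J → X) → Y} (hg : ∀ k, Measurable (g k)) :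
    (infinitePi μ).map (fun ω k => g k fun j => ω (τ (k, j))) =
      infinitePi fun k => (infinitePi fun j => μ (τ (k, j))).map (g k) := by
  have h : (fun (ω : ι → X) k => g k fun j => ω (τ (k, j))) =
      (fun (ω : κ → J → X) k => g k (ω k)) ∘ MeasurableEquiv.curry κ J X ∘ fun ω e => ω (τ e) :=
    rfl
  have hm : Measurable fun (ω : ι → X) e => ω (τ e) :=
    measurable_pi_lambda _ fun e => measurable_pi_apply _
  rw [h, ← map_map (by fun_prop) (by fun_prop), ← map_map (by fun_prop) hm,
    map_infinitePi_infinitePi_of_inj hτ, infinitePi_map_curry fun k j => μ (τ (k, j)),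
    infinitePi_map_pi _ hg]

/-- If an event sees only one of the two components of each coordinate, given all the other
coordinates, then its probability depends only on the laws of the components. -/
lemma infinitePi_congr_of_marginals {κ X : Type*} [MeasurableSpace X] [Nonempty X]
    {μ ν : κ → Measure (X × X)} [∀ k, IsProbabilityMeasure (μ k)]
    [∀ k, IsProbabilityMeasure (ν k)]
    (hfst : ∀ k, (μ k).map Prod.fst = (ν k).map Prod.fst)
    (hsnd : ∀ k, (μ k).map Prod.snd = (ν k).map Prod.snd) {A : Set (κ → X × X)}
    (hA : MeasurableSet A) [DecidableEq κ]
    (hsee : ∀ k ω, (∀ z w : X × X, z.1 = w.1 → Function.update ω k z ∈ A →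
        Function.update ω k w ∈ A) ∨
      ∀ z w : X × X, z.2 = w.2 → Function.update ω k z ∈ A → Function.update ω k w ∈ A)
    (F : Finset κ) (hF : DeterminedBy (F : Set κ) A) : infinitePi μ A = infinitePi ν A := by
  classical
  obtain ⟨x₀⟩ := ‹Nonempty X›
  have hval (k : κ) (ω : κ → X × X) :
      μ k {z | Function.update ω k z ∈ A} = ν k {z | Function.update ω k z ∈ A} := by
    rcases hsee k ω with h | h
    · have hpre : {z | Function.update ω k z ∈ A} =
          Prod.fst ⁻¹' {x | Function.update ω k (x, x₀) ∈ A} :=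
        Set.ext fun z => ⟨h z (z.1, x₀) rfl, h (z.1, x₀) z rfl⟩
      have hB : MeasurableSet {x | Function.update ω k (x, x₀) ∈ A} :=
        (measurable_id.prodMk measurable_const) (measurable_update ω hA)
      rw [hpre, ← map_apply measurable_fst hB, hfst, map_apply measurable_fst hB]
    · have hpre : {z | Function.update ω k z ∈ A} =
          Prod.snd ⁻¹' {x | Function.update ω k (x₀, x) ∈ A} :=
        Set.ext fun z => ⟨h z (x₀, z.2) rfl, h (x₀, z.2) z rfl⟩
      have hB : MeasurableSet {x | Function.update ω k (x₀, x) ∈ A} :=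
        (measurable_const.prodMk measurable_id) (measurable_update ω hA)
      rw [hpre, ← map_apply measurable_snd hB, hsnd, map_apply measurable_snd hB]
  have hprob (G : Finset κ) (k : κ) : IsProbabilityMeasure (if k ∈ G then ν k else μ k) := by
    split_ifs <;> infer_instance
  have hstep (G : Finset κ) : infinitePi (fun k => if k ∈ G then ν k else μ k) A =
      infinitePi μ A := by
    induction G using Finset.induction_on with
    | empty => simp
    | @insert k G hk ih =>
      rw [← ih]
      have h₁ : (fun i => if i ∈ insert k G then ν i else μ i) =
          Function.update (fun i => if i ∈ G then ν i else μ i) k (ν k) := by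
        funext i
        by_cases hi : i = k
        · subst hi
          simp
        · simp [hi]
      have h₂ : (fun i => if i ∈ G then ν i else μ i) =
          Function.update (fun i => if i ∈ G then ν i else μ i) k (μ k) := by
        funext i
        by_cases hi : i = k
        · subst hi
          simp [hk]
        · simp [hi]
      have inst₁ : ∀ i, IsProbabilityMeasure
          (Function.update (fun i => if i ∈ G then ν i else μ i) k (ν k) i) :=
        fun i => congrFun h₁ i ▸ hprob (insert k G) i
      have inst₂ : ∀ i, IsProbabilityMeasure
          (Function.update (fun i => if i ∈ G then ν i else μ i) k (μ k) i) :=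
        fun i => congrFun h₂ i ▸ hprob G i
      conv_rhs => rw [h₂]
      rw [h₁, infinitePi_update_apply _ k (ν k) hA, infinitePi_update_apply _ k (μ k) hA]
      exact lintegral_congr fun ω => (hval k ω).symm
  rw [← hstep F]
  exact infinitePi_congr_of_determinedBy (fun i hi => if_pos hi) hA hF

namespace Graph

variable {V ι : Type*} (G : Graph V ι)

/-- Two mutually reverse edges cannot both matter for the existence of a path from `o` to the
complement of `D`. -/
lemma exitEvent_reverse_edges {e e' : ι} (h₁ : G.src e' = G.dst e) (h₂ : G.dst e' = G.src e)
    {Ω : Bool × Bool → ι → Bool} (he : ∀ z, Ω z e = z.1) (he' : ∀ z, Ω z e' = z.2)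
    (hne : ∀ z w i, i ≠ e → i ≠ e' → Ω z i = Ω w i) (D : Set V) (o : V) :
    (∀ z w : Bool × Bool, z.1 = w.1 → Ω z ∈ G.exitEvent Set.univ D o →
      Ω w ∈ G.exitEvent Set.univ D o) ∨
    ∀ z w : Bool × Bool, z.2 = w.2 → Ω z ∈ G.exitEvent Set.univ D o →
      Ω w ∈ G.exitEvent Set.univ D o := by
  have hmono (w : Bool × Bool) {b : V} (h : G.Conn (Ω (false, false)) Set.univ o b) :
      G.Conn (Ω w) Set.univ o b := by
    refine h.mono (fun i hi => ?_) subset_rfl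
    by_cases hie : i = e
    · simp [hie, he] at hi
    by_cases hie' : i = e'
    · simp [hie', he'] at hi
    rw [← hi]
    exact hne _ _ i hie hie'
  have hind (z w : Bool × Bool)
      (hz : ∀ i, G.Conn (Ω w) Set.univ o (G.src i) → (i = e ∨ i = e') → Ω z i = true →
        G.Conn (Ω w) Set.univ o (G.dst i)) (h : Ω z ∈ G.exitEvent Set.univ D o) :
      Ω w ∈ G.exitEvent Set.univ D o := by
    obtain ⟨b, hb, hconn⟩ := h
    refine ⟨b, hb, ?_⟩
    clear hb
    induction hconn with
    | refl => exact .refl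
    | tail _ hstep ih =>
      obtain ⟨i, rfl, rfl, hi, -, -⟩ := hstep
      by_cases hie : i = e ∨ i = e'
      · exact hz i ih hie hi
      · rw [not_or] at hie
        exact ih.tail ⟨i, rfl, rfl, hne z w i hie.1 hie.2 ▸ hi, trivial, trivial⟩
  by_cases hx : G.Conn (Ω (false, false)) Set.univ o (G.src e)
  · refine Or.inl fun z w hzw => hind z w fun i hi hie hopen => ?_
    rcases hie with rfl | rfl
    · exact hi.tail ⟨i, rfl, rfl, by rw [he, ← hzw, ← he, hopen], trivial, trivial⟩
    · exact h₂ ▸ hmono w hx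
  by_cases hy : G.Conn (Ω (false, false)) Set.univ o (G.src e')
  · refine Or.inr fun z w hzw => hind z w fun i hi hie hopen => ?_
    rcases hie with rfl | rfl
    · exact h₁ ▸ hmono w hy
    · exact hi.tail ⟨i, rfl, rfl, by rw [he', ← hzw, ← he', hopen], trivial, trivial⟩
  refine Or.inl fun z w _ h => ?_
  have : Ω (false, false) ∈ G.exitEvent Set.univ D o := by
    refine hind z _ (fun i hi hie _ => ?_) h
    rcases hie with rfl | rfl
    · exact absurd hi hx
    · exact absurd hi hy
  obtain ⟨b, hb, hconn⟩ := this
  exact ⟨b, hb, hmono w hconn⟩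

end Graph

/-- The configuration of directed edges given by the states of both directions of each edge. -/
def directed (c : (ℤ × ℤ) × Bool → Bool × Bool) : (ℤ × ℤ) × Bool × Bool → Bool :=
  fun e => if e.2.2 then (c (e.1, e.2.1)).1 else (c (e.1, e.2.1)).2

lemma measurable_directed : Measurable directed := by
  refine measurable_pi_lambda _ fun e => ?_
  unfold directed
  split_ifs
  · exact measurable_fst.comp (measurable_pi_apply _)
  · exact measurable_snd.comp (measurable_pi_apply _)

/-- The states of the two directions of an edge may be coupled without changing the probability
of leaving a box. -/
theorem infinitePi_directed_exitEvent {μ : (ℤ × ℤ) × Bool → Measure (Bool × Bool)}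
    [∀ k, IsProbabilityMeasure (μ k)] {f : Bool → Bool → ℝ}
    (hfst : ∀ k, (μ k).map Prod.fst = bern (f k.2 true))
    (hsnd : ∀ k, (μ k).map Prod.snd = bern (f k.2 false)) (n : ℕ) :
    (infinitePi μ).real (directed ⁻¹' sq.exitEvent Set.univ (box n) 0) =
      exitProb (dirParam f) n := by
  let τ : ((ℤ × ℤ) × Bool) × Bool → (ℤ × ℤ) × Bool × Bool := fun e => (e.1.1, e.1.2, e.2)
  have hτ : Function.Injective τ := by
    rintro ⟨⟨a, b⟩, c⟩ ⟨⟨a', b'⟩, c'⟩ h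
    simp_all [τ]
  let g : (Bool → Bool) → Bool × Bool := fun x => (x true, x false)
  have hg : Measurable g := (measurable_pi_apply _).prodMk (measurable_pi_apply _)
  let split : ((ℤ × ℤ) × Bool × Bool → Bool) → (ℤ × ℤ) × Bool → Bool × Bool :=
    fun ω k => g fun j => ω (τ (k, j))
  have hsplit : Measurable split := measurable_pi_lambda _ fun k =>
    (measurable_pi_apply (τ (k, true))).prodMk (measurable_pi_apply (τ (k, false)))
  let ν : (ℤ × ℤ) × Bool → Measure (Bool × Bool) := fun k =>
    (infinitePi fun j => bern (dirParam f (τ (k, j)))).map g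
  have hν (k) : IsProbabilityMeasure (ν k) := isProbabilityMeasure_map hg.aemeasurable
  have hmap : (bernPi (dirParam f)).map split = infinitePi ν :=
    infinitePi_map_blocks (fun e => bern (dirParam f e)) hτ (g := fun _ => g) fun _ => hg
  have hE := measurable_directed (sq.measurableSet_exitEvent Set.univ (box n) 0)
  have hinv (ω : (ℤ × ℤ) × Bool × Bool → Bool) : directed (split ω) = ω := by
    funext ⟨v, a, b⟩
    cases b <;> rfl
  have hexit : exitProb (dirParam f) n =
      (infinitePi ν).real (directed ⁻¹' sq.exitEvent Set.univ (box n) 0) := by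
    rw [← hmap, map_measureReal_apply hsplit hE, exitProb]
    congr 1
    ext ω
    simp only [Set.mem_preimage, hinv]
  rw [hexit, measureReal_def, measureReal_def]
  congr 1
  refine infinitePi_congr_of_marginals (fun k => ?_) (fun k => ?_) hE (fun k ω => ?_)
    (box (n + 1) ×ˢ Finset.univ) ?_
  · rw [hfst, map_map measurable_fst hg]
    exact (infinitePi_map_eval (fun j => bern (dirParam f (τ (k, j)))) true).symm
  · rw [hsnd, map_map measurable_snd hg]
    exact (infinitePi_map_eval (fun j => bern (dirParam f (τ (k, j)))) false).symm
  · obtain ⟨v, a⟩ := k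
    refine sq.exitEvent_reverse_edges (e := (v, a, true)) (e' := (v, a, false)) rfl rfl
      (Ω := fun z => directed (Function.update ω (v, a) z)) (fun z => by simp [directed])
      (fun z => by simp [directed]) ?_ _ _
    rintro z w ⟨v', a', b⟩ h h'
    have : (v', a') ≠ (v, a) := by
      rintro ⟨⟩
      cases b <;> simp_all
    simp [directed, this]
  · intro ω ω' h
    refine (sq.determinedBy_exitEvent_univ _ _) _ _ ?_
    rintro ⟨⟨x, y⟩, a, b⟩ he
    have : ω ((x, y), a) = ω' ((x, y), a) := by
      refine h _ ?_
      simp only [Finset.coe_product, Set.mem_prod, Finset.coe_univ, Set.mem_univ, and_true,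
        Finset.mem_coe]
      cases a <;> cases b <;> simp [sq, shift, mem_box] at he ⊢ <;> omega
    simp [directed, this]

end Coupling

section Slab

open Measure

lemma eq_bern {μ : Measure Bool} [IsProbabilityMeasure μ] {q : ℝ} (h₀ : 0 ≤ q) (h₁ : q ≤ 1)
    (h : μ.real {true} = q) : μ = bern q := by
  have hq : ∀ b, μ.real {b} = (bern q).real {b} := by
    have ht : (bern q).real {true} = q := by
      simp [measureReal_def, bern_apply h₀ h₁, h₀]
    have hc : ({false} : Set Bool) = {true}ᶜ := by
      ext b
      cases b <;> simp
    rintro (_ | _)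
    · rw [hc, probReal_compl_eq_one_sub (measurableSet_singleton _),
        probReal_compl_eq_one_sub (measurableSet_singleton _), ht, h]
    · rw [ht, h]
  refine ext_of_singleton fun b => ?_
  exact (measureReal_eq_measureReal_iff).1 (hq b)

/-- The probability that a bit of parameter `p` equals `b`. -/
def weight (p : ℝ) (b : Bool) : ℝ := if b then p else 1 - p

lemma bern_real_singleton {p : ℝ} (hp₀ : 0 ≤ p) (hp₁ : p ≤ 1) (b : Bool) :
    (bern p).real {b} = weight p b := by
  cases b <;> simp [measureReal_def, bern_apply hp₀ hp₁, weight, hp₀, hp₁]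

/-- The probability that an edge or a given detour of length three is open. -/
lemma bernPi_real_edge_or_detour {p : ℝ} (hp₀ : 0 ≤ p) (hp₁ : p ≤ 1) (a b c d : Bool) :
    (bernPi fun _ : Fin 4 => p).real {x | x 0 = a ∨ x 1 = b ∧ x 2 = c ∧ x 3 = d} =
      weight p a + weight p (!a) * (weight p b * weight p c * weight p d) := by
  have hm : MeasurableSet {x : Fin 4 → Bool | x 0 = a ∨ x 1 = b ∧ x 2 = c ∧ x 3 = d} :=
    Set.Finite.measurableSet (Set.toFinite _)
  have hpi : (bernPi fun _ : Fin 4 => p).real {x | x 1 = b ∧ x 2 = c ∧ x 3 = d} =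
      weight p b * weight p c * weight p d := by
    have : {x : Fin 4 → Bool | x 1 = b ∧ x 2 = c ∧ x 3 = d} =
        (({1, 2, 3} : Finset (Fin 4)) : Set (Fin 4)).pi
          (fun i => ({(![a, b, c, d] : Fin 4 → Bool) i} : Set Bool)) := by
      ext x
      simp
    rw [this, measureReal_def, bernPi, infinitePi_pi _ fun i _ => measurableSet_singleton _,
      ENNReal.toReal_prod]
    simp only [← measureReal_def, bern_real_singleton hp₀ hp₁]
    simp [mul_assoc]
  rw [bernPi_real_eq_force (fun _ : Fin 4 => p) 0 hp₀ hp₁ hm]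
  have hforce (e : Bool) : force (0 : Fin 4) e
      {x : Fin 4 → Bool | x 0 = a ∨ x 1 = b ∧ x 2 = c ∧ x 3 = d} =
      if e = a then Set.univ else {x | x 1 = b ∧ x 2 = c ∧ x 3 = d} := by
    ext x
    by_cases hea : e = a <;> simp [force, hea]
  rw [hforce, hforce]
  cases a
  · simp [hpi, weight]
    ring
  · simp [hpi, weight]

/-- The edges of the slab used to realise the edge `k` of the square lattice: the edge itself, in
the layer `0`, and for a horizontal edge the three edges of a detour through another layer. -/
def block (e : ((ℤ × ℤ) × Bool) × Fin 4) : Edge3 :=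
  if e.1.2 then
    ![((e.1.1.1, e.1.1.2, 0), 0),
      ((e.1.1.1, e.1.1.2, if e.1.1.1 % 2 = 0 then 0 else -1), 2),
      ((e.1.1.1, e.1.1.2, if e.1.1.1 % 2 = 0 then 1 else -1), 0),
      ((e.1.1.1 + 1, e.1.1.2, if e.1.1.1 % 2 = 0 then 0 else -1), 2)] e.2
  else ((e.1.1.1, e.1.1.2, e.2.val), 1)

lemma block_injective : Function.Injective block := by
  rintro ⟨⟨⟨x, y⟩, a⟩, j⟩ ⟨⟨⟨x', y'⟩, a'⟩, j'⟩ h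
  cases a <;> cases a'
  · simp only [block, Bool.false_eq_true, if_false, Prod.mk.injEq, Nat.cast_inj, and_true] at h
    ext <;> simp [h]
  · exfalso
    fin_cases j' <;> simp [block] at h
  · exfalso
    fin_cases j <;> simp [block] at h
  · fin_cases j <;> fin_cases j' <;> simp [block] at h ⊢ <;>
    first
    | exact ⟨h.1, h.2⟩
    | omega

/-- The states of the two directions of an edge of the square lattice, given the states of the
edges of its block. -/
def blockState (k : (ℤ × ℤ) × Bool) (x : Fin 4 → Bool) : Bool × Bool :=
  if k.2 then
    let u := decide (k.1.1 % 2 = 0)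
    (decide (x 0 = true ∨ x 1 = u ∧ x 2 = true ∧ x 3 = !u),
      decide (x 0 = false ∨ x 1 = !u ∧ x 2 = false ∧ x 3 = u))
  else (x 0, !x 0)

/-- The parameters of the square lattice model realised inside the slab. -/
def slabParam (p : ℝ) (hor fwd : Bool) : ℝ :=
  weight p fwd + if hor then p ^ 2 * (1 - p) ^ 2 else 0

lemma slabParam_mem {p : ℝ} (hp₀ : 0 ≤ p) (hp₁ : p ≤ 1) (a b : Bool) :
    slabParam p a b ∈ Set.Icc (0 : ℝ) 1 := by
  have h₁ : 0 ≤ 1 - p := by linarith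
  have h₂ : p * (1 - p) ≤ 1 := by nlinarith
  have h₃ : 0 ≤ p * (1 - p) := by positivity
  have h₄ : p * (p * (1 - p)) ≤ 1 := by nlinarith
  have h₅ : (1 - p) * (p * (1 - p)) ≤ 1 := by nlinarith
  cases a <;> cases b <;> simp only [slabParam, weight, Bool.false_eq_true, if_true, if_false] <;>
    constructor <;> nlinarith

lemma map_fst_blockState {p : ℝ} (hp₀ : 0 ≤ p) (hp₁ : p ≤ 1) (k : (ℤ × ℤ) × Bool) :
    ((bernPi fun _ : Fin 4 => p).map (blockState k)).map Prod.fst =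
      bern (slabParam p k.2 true) := by
  have hm : Measurable (blockState k) := measurable_of_countable _
  rw [map_map measurable_fst hm]
  have := isProbabilityMeasure_map (μ := bernPi fun _ : Fin 4 => p)
    (measurable_fst.comp hm).aemeasurable
  refine eq_bern (slabParam_mem hp₀ hp₁ _ _).1 (slabParam_mem hp₀ hp₁ _ _).2 ?_
  rw [map_measureReal_apply (measurable_fst.comp hm) (measurableSet_singleton _)]
  obtain ⟨v, _ | _⟩ := k
  · have : Prod.fst ∘ blockState (v, false) ⁻¹' {true} = {x : Fin 4 → Bool | x 0 = true} := by
      ext x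
      simp [blockState]
    rw [this, bernPi_real_eval _ hp₀ hp₁]
    simp [slabParam, weight]
  · have : Prod.fst ∘ blockState (v, true) ⁻¹' {true} = {x : Fin 4 → Bool | x 0 = true ∨
        x 1 = decide (v.1 % 2 = 0) ∧ x 2 = true ∧ x 3 = !decide (v.1 % 2 = 0)} := by
      ext x
      simp [blockState]
    rw [this, bernPi_real_edge_or_detour hp₀ hp₁]
    by_cases hv : v.1 % 2 = 0 <;> simp [slabParam, weight, hv] <;> ring

lemma map_snd_blockState {p : ℝ} (hp₀ : 0 ≤ p) (hp₁ : p ≤ 1) (k : (ℤ × ℤ) × Bool) :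
    ((bernPi fun _ : Fin 4 => p).map (blockState k)).map Prod.snd =
      bern (slabParam p k.2 false) := by
  have hm : Measurable (blockState k) := measurable_of_countable _
  rw [map_map measurable_snd hm]
  have := isProbabilityMeasure_map (μ := bernPi fun _ : Fin 4 => p)
    (measurable_snd.comp hm).aemeasurable
  refine eq_bern (slabParam_mem hp₀ hp₁ _ _).1 (slabParam_mem hp₀ hp₁ _ _).2 ?_
  rw [map_measureReal_apply (measurable_snd.comp hm) (measurableSet_singleton _)]
  obtain ⟨v, _ | _⟩ := k
  · have : Prod.snd ∘ blockState (v, false) ⁻¹' {true} = {x : Fin 4 → Bool | x 0 = true}ᶜ := by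
      ext x
      simp [blockState]
    rw [this, probReal_compl_eq_one_sub (measurableSet_eval_true _),
      bernPi_real_eval _ hp₀ hp₁]
    simp [slabParam, weight]
  · have : Prod.snd ∘ blockState (v, true) ⁻¹' {true} = {x : Fin 4 → Bool | x 0 = false ∨
        x 1 = (!decide (v.1 % 2 = 0)) ∧ x 2 = false ∧ x 3 = decide (v.1 % 2 = 0)} := by
      ext x
      simp [blockState]
    rw [this, bernPi_real_edge_or_detour hp₀ hp₁]
    by_cases hv : v.1 % 2 = 0 <;> simp [slabParam, weight, hv] <;> ring

/-- The configuration of the square lattice realised by a configuration of the slab. -/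
def slabState (ω : Config3) : (ℤ × ℤ) × Bool × Bool → Bool :=
  directed fun k => blockState k fun j => ω (block (k, j))

lemma measurable_slabState : Measurable slabState := by
  refine measurable_directed.comp (measurable_pi_lambda _ fun k => ?_)
  exact (measurable_of_countable (blockState k)).comp
    (measurable_pi_lambda (fun (ω : Config3) j => ω (block (k, j))) fun j => measurable_pi_apply _)

lemma one_sub_exp_le_slabState {p : ℝ} (hp₀ : 0 ≤ p) (hp₁ : p ≤ 1) (n : ℕ) :
    1 - Real.exp (-(p ^ 2 * (1 - p) ^ 2 / 2)) ≤ (bernPi fun _ : Edge3 => p).real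
      (slabState ⁻¹' sq.exitEvent Set.univ (box n) 0) := by
  have hblock (k) : Measurable (blockState k) := measurable_of_countable _
  have hmap := infinitePi_map_blocks (fun _ : Edge3 => bern p) block_injective hblock
  have hprob (k) : IsProbabilityMeasure ((bernPi fun _ : Fin 4 => p).map (blockState k)) :=
    isProbabilityMeasure_map (hblock k).aemeasurable
  have hpre : slabState ⁻¹' sq.exitEvent Set.univ (box n) 0 =
      (fun (ω : Config3) k => blockState k fun j => ω (block (k, j))) ⁻¹'
        (directed ⁻¹' sq.exitEvent Set.univ (box n) 0) := rfl
  have hm : Measurable fun (ω : Config3) k => blockState k fun j => ω (block (k, j)) :=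
    measurable_pi_lambda _ fun k => (hblock k).comp
      (measurable_pi_lambda (fun (ω : Config3) j => ω (block (k, j))) fun j =>
        measurable_pi_apply _)
  rw [hpre, ← map_measureReal_apply hm
    (measurable_directed (sq.measurableSet_exitEvent _ _ _)), bernPi, hmap]
  refine le_of_le_of_eq ?_ (infinitePi_directed_exitEvent (f := slabParam p)
    (map_fst_blockState hp₀ hp₁) (map_snd_blockState hp₀ hp₁) n).symm
  set ε := p ^ 2 * (1 - p) ^ 2 / 2 with hε
  have hε₀ : 0 ≤ ε := by positivity
  have h₁ : 0 ≤ 1 - p := by linarith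
  have hεp : ε ≤ p := by nlinarith [mul_nonneg hp₀ h₁, mul_nonneg hp₀ (mul_nonneg hp₀ h₁)]
  have hεp' : ε ≤ 1 - p := by nlinarith [mul_nonneg hp₀ h₁, mul_nonneg h₁ (mul_nonneg hp₀ h₁)]
  have hf := one_sub_exp_le_exitProb
    (f := fun a b => weight p b + if a then ε else -ε) hε₀ (fun a b => by
      have := slabParam_mem hp₀ hp₁ a b
      cases a <;> cases b <;>
        simp only [slabParam, weight, Bool.false_eq_true, if_true, if_false, Set.mem_Icc]
          at this ⊢ <;>
        constructor <;> linarith)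
    (fun a b => by cases a <;> cases b <;> simp [weight] <;> ring) n
  refine hf.trans_eq ?_
  congr 2
  funext a b
  cases a
  · simp [slabParam, hε]
  · simp [slabParam, hε]
    ring

/-- A step of the random orientation inside the slab. -/
def slabStep (ω : Config3) (u v : ℤ × ℤ × ℤ) : Prop := gStep3 ω u v ∧ u ∈ slab ∧ v ∈ slab

/-- The embedding of the square lattice as the layer `0` of the slab. -/
def layer (v : ℤ × ℤ) : ℤ × ℤ × ℤ := (v.1, v.2, 0)

lemma slabStep_pos {ω : Config3} {e : Edge3} (h : ω e = true) (hs : e3Src e ∈ slab)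
    (hd : e3Dst e ∈ slab) : slabStep ω (e3Src e) (e3Dst e) :=
  ⟨⟨e, Or.inl ⟨rfl, rfl, h⟩⟩, hs, hd⟩

lemma slabStep_neg {ω : Config3} {e : Edge3} (h : ω e = false) (hs : e3Src e ∈ slab)
    (hd : e3Dst e ∈ slab) : slabStep ω (e3Dst e) (e3Src e) :=
  ⟨⟨e, Or.inr ⟨rfl, rfl, h⟩⟩, hd, hs⟩

lemma reflTransGen_slabStep_of_slabState {ω : Config3} {e : (ℤ × ℤ) × Bool × Bool}
    (h : slabState ω e = true) :
    Relation.ReflTransGen (slabStep ω) (layer (sq.src e)) (layer (sq.dst e)) := by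
  have pos {e : Edge3} (h : ω e = true) (hs : e3Src e ∈ slab) (hd : e3Dst e ∈ slab) :=
    Relation.ReflTransGen.single (slabStep_pos h hs hd)
  have neg {e : Edge3} (h : ω e = false) (hs : e3Src e ∈ slab) (hd : e3Dst e ∈ slab) :=
    Relation.ReflTransGen.single (slabStep_neg h hs hd)
  obtain ⟨⟨x, y⟩, _ | _, _ | _⟩ := e
  · have h : ω ((x, y, 0), 1) = false := by simpa [slabState, directed, blockState, block] using h
    simpa [e3Src, e3Dst, sq, shift, layer] using
      neg h (by simp [slab, e3Src]) (by simp [slab, e3Dst])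
  · have h : ω ((x, y, 0), 1) = true := by simpa [slabState, directed, blockState, block] using h
    simpa [e3Src, e3Dst, sq, shift, layer] using
      pos h (by simp [slab, e3Src]) (by simp [slab, e3Dst])
  · by_cases hx : x % 2 = 0 <;> simp [slabState, directed, blockState, block, hx] at h <;>
      rcases h with h | ⟨h₁, h₂, h₃⟩
    · simpa [e3Src, e3Dst, sq, shift, layer] using
        neg h (by simp [slab, e3Src]) (by simp [slab, e3Dst])
    · have s₁ := pos h₃ (by simp [slab, e3Src]) (by simp [slab, e3Dst])
      have s₂ := neg h₂ (by simp [slab, e3Src]) (by simp [slab, e3Dst])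
      have s₃ := neg h₁ (by simp [slab, e3Src]) (by simp [slab, e3Dst])
      simp [e3Src, e3Dst] at s₁ s₂ s₃
      simpa [sq, shift, layer] using (s₁.trans s₂).trans s₃
    · simpa [e3Src, e3Dst, sq, shift, layer] using
        neg h (by simp [slab, e3Src]) (by simp [slab, e3Dst])
    · have s₁ := neg h₃ (by simp [slab, e3Src]) (by simp [slab, e3Dst])
      have s₂ := neg h₂ (by simp [slab, e3Src]) (by simp [slab, e3Dst])
      have s₃ := pos h₁ (by simp [slab, e3Src]) (by simp [slab, e3Dst])
      simp [e3Src, e3Dst] at s₁ s₂ s₃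
      simpa [sq, shift, layer] using (s₁.trans s₂).trans s₃
  · by_cases hx : x % 2 = 0 <;> simp [slabState, directed, blockState, block, hx] at h <;>
      rcases h with h | ⟨h₁, h₂, h₃⟩
    · simpa [e3Src, e3Dst, sq, shift, layer] using
        pos h (by simp [slab, e3Src]) (by simp [slab, e3Dst])
    · have s₁ := pos h₁ (by simp [slab, e3Src]) (by simp [slab, e3Dst])
      have s₂ := pos h₂ (by simp [slab, e3Src]) (by simp [slab, e3Dst])
      have s₃ := neg h₃ (by simp [slab, e3Src]) (by simp [slab, e3Dst])
      simp [e3Src, e3Dst] at s₁ s₂ s₃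
      simpa [sq, shift, layer] using (s₁.trans s₂).trans s₃
    · simpa [e3Src, e3Dst, sq, shift, layer] using
        pos h (by simp [slab, e3Src]) (by simp [slab, e3Dst])
    · have s₁ := neg h₁ (by simp [slab, e3Src]) (by simp [slab, e3Dst])
      have s₂ := pos h₂ (by simp [slab, e3Src]) (by simp [slab, e3Dst])
      have s₃ := pos h₃ (by simp [slab, e3Src]) (by simp [slab, e3Dst])
      simp [e3Src, e3Dst] at s₁ s₂ s₃
      simpa [sq, shift, layer] using (s₁.trans s₂).trans s₃

lemma reflTransGen_slabStep_of_conn {ω : Config3} {a b : ℤ × ℤ}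
    (h : sq.Conn (slabState ω) Set.univ a b) :
    Relation.ReflTransGen (slabStep ω) (layer a) (layer b) := by
  induction h with
  | refl => exact .refl
  | tail _ hstep ih =>
    obtain ⟨e, rfl, rfl, he, -, -⟩ := hstep
    exact ih.trans (reflTransGen_slabStep_of_slabState he)

end Slab

section Digits

open Measure

/-- The uniform measure on `[0, 1)`. -/
noncomputable abbrev uniform : Measure ℝ := volume.restrict (Set.Ico (0 : ℝ) 1)

lemma measurable_expand (p : ℝ) : Measurable (expand p) :=
  Measurable.ite measurableSet_Iio (measurable_id.div_const p)
    ((measurable_id.sub_const p).div_const (1 - p))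

lemma measurable_bernDigit (p : ℝ) (n : ℕ) : Measurable (bernDigit p n) := by
  have h : MeasurableSet {x | (expand p)^[n] x < p} :=
    (measurable_expand p).iterate n measurableSet_Iio
  refine measurable_to_bool ?_
  convert h using 1
  ext x
  simp [bernDigit]

lemma uniform_lt_inter_preimage_expand {p : ℝ} (hp₀ : 0 < p) (hp₁ : p < 1) {C : Set ℝ}
    (hC : MeasurableSet C) :
    uniform ({x | x < p} ∩ expand p ⁻¹' C) = ENNReal.ofReal p * uniform C := by
  have hset : ({x | x < p} ∩ expand p ⁻¹' C) ∩ Set.Ico 0 1 =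
      (· * p⁻¹) ⁻¹' (C ∩ Set.Ico 0 1) := by
    ext x
    simp only [Set.mem_inter_iff, Set.mem_ofPred_eq, Set.mem_preimage, Set.mem_Ico,
      ← div_eq_mul_inv, div_lt_one hp₀]
    constructor
    · rintro ⟨⟨h₁, h₂⟩, h₃, -⟩
      rw [expand, if_pos h₁] at h₂
      exact ⟨h₂, by positivity, h₁⟩
    · rintro ⟨h₁, h₂, h₃⟩
      rw [le_div_iff₀ hp₀, zero_mul] at h₂
      exact ⟨⟨h₃, by rwa [expand, if_pos h₃]⟩, h₂, h₃.trans hp₁⟩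
  have hm : MeasurableSet {x : ℝ | x < p} := measurableSet_Iio
  rw [restrict_apply (hm.inter (measurable_expand p hC)), hset,
    Real.volume_preimage_mul_right (inv_ne_zero hp₀.ne'), inv_inv, abs_of_pos hp₀,
    restrict_apply hC]

lemma uniform_ge_inter_preimage_expand {p : ℝ} (hp₀ : 0 < p) (hp₁ : p < 1) {C : Set ℝ}
    (hC : MeasurableSet C) :
    uniform ({x | x < p}ᶜ ∩ expand p ⁻¹' C) = ENNReal.ofReal (1 - p) * uniform C := by
  have hp : 0 < 1 - p := by linarith
  have hset : ({x | x < p}ᶜ ∩ expand p ⁻¹' C) ∩ Set.Ico 0 1 =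
      (· - p) ⁻¹' ((· * (1 - p)⁻¹) ⁻¹' (C ∩ Set.Ico 0 1)) := by
    ext x
    simp only [Set.mem_inter_iff, Set.mem_compl_iff, Set.mem_ofPred_eq, Set.mem_preimage,
      Set.mem_Ico, ← div_eq_mul_inv, div_lt_one hp, not_lt]
    constructor
    · rintro ⟨⟨h₁, h₂⟩, -, h₃⟩
      rw [expand, if_neg h₁.not_gt] at h₂
      exact ⟨h₂, div_nonneg (by linarith) hp.le, by linarith⟩
    · rintro ⟨h₁, h₂, h₃⟩
      rw [le_div_iff₀ hp, zero_mul] at h₂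
      have h₄ : p ≤ x := by linarith
      exact ⟨⟨h₄, by rwa [expand, if_neg h₄.not_gt]⟩, by linarith, by linarith⟩
  have hlt : MeasurableSet {x : ℝ | x < p} := measurableSet_Iio
  have hm : MeasurableSet ((· * (1 - p)⁻¹) ⁻¹' (C ∩ Set.Ico 0 1)) :=
    (measurable_id.mul_const _) (hC.inter measurableSet_Ico)
  rw [restrict_apply (hlt.compl.inter (measurable_expand p hC)), hset,
    (measurePreserving_sub_right volume p).measure_preimage hm.nullMeasurableSet,
    Real.volume_preimage_mul_right (inv_ne_zero hp.ne'), inv_inv, abs_of_pos hp,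
    restrict_apply hC]

/-- The first digit of a uniform point is independent of its image under `expand p`, which is
uniform. -/
lemma uniform_digit_inter_preimage_expand {p : ℝ} (hp₀ : 0 < p) (hp₁ : p < 1) (B : Set Bool)
    {C : Set ℝ} (hC : MeasurableSet C) :
    uniform ({x | decide (x < p) ∈ B} ∩ expand p ⁻¹' C) = bern p B * uniform C := by
  classical
  have hm : MeasurableSet {x : ℝ | x < p} := measurableSet_Iio
  have hlt := uniform_lt_inter_preimage_expand hp₀ hp₁ hC
  have hge := uniform_ge_inter_preimage_expand hp₀ hp₁ hC
  rw [bern_apply hp₀.le hp₁.le, add_mul, ← measure_inter_add_sdiff _ hm]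
  have h₁ : {x | decide (x < p) ∈ B} ∩ expand p ⁻¹' C ∩ {x | x < p} =
      if true ∈ B then {x | x < p} ∩ expand p ⁻¹' C else ∅ := by
    ext x
    by_cases hx : x < p <;> by_cases hB : true ∈ B <;> simp [hx, hB]
  have h₂ : ({x | decide (x < p) ∈ B} ∩ expand p ⁻¹' C) \ {x | x < p} =
      if false ∈ B then {x | x < p}ᶜ ∩ expand p ⁻¹' C else ∅ := by
    ext x
    by_cases hx : x < p <;> by_cases hB : false ∈ B <;> simp [hx, hB]
  rw [h₁, h₂]
  congr 1
  · by_cases hB : true ∈ B <;> simp only [hB, if_true, if_false, hlt] <;> simp [hB]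
  · by_cases hB : false ∈ B <;> simp only [hB, if_true, if_false, hge] <;> simp [hB]

lemma uniform_digits {p : ℝ} (hp₀ : 0 < p) (hp₁ : p < 1) (n : ℕ) (t : ℕ → Set Bool) :
    uniform {x | ∀ i < n, bernDigit p i x ∈ t i} = ∏ i ∈ Finset.range n, bern p (t i) := by
  induction n generalizing t with
  | zero => simp
  | succ n ih =>
    have hset : {x | ∀ i < n + 1, bernDigit p i x ∈ t i} =
        {x | decide (x < p) ∈ t 0} ∩
          expand p ⁻¹' {x | ∀ i < n, bernDigit p i x ∈ t (i + 1)} := by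
      ext x
      simp only [Set.mem_ofPred_eq, Set.mem_inter_iff, Set.mem_preimage]
      constructor
      · exact fun h => ⟨h 0 n.succ_pos, fun i hi => h (i + 1) (Nat.succ_lt_succ hi)⟩
      · rintro ⟨h₁, h₂⟩ (_ | i) hi
        · exact h₁
        · exact h₂ i (Nat.lt_of_succ_lt_succ hi)
    have hm : MeasurableSet {x | ∀ i < n, bernDigit p i x ∈ t (i + 1)} := by
      have : {x | ∀ i < n, bernDigit p i x ∈ t (i + 1)} =
          ⋂ i, ⋂ _ : i < n, bernDigit p i ⁻¹' t (i + 1) := by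
        ext x
        simp
      rw [this]
      exact MeasurableSet.iInter fun i => MeasurableSet.iInter fun _ =>
        measurable_bernDigit p i (Set.Finite.measurableSet (Set.toFinite _))
    rw [hset, uniform_digit_inter_preimage_expand hp₀ hp₁ _ hm, ih fun i => t (i + 1),
      Finset.prod_range_succ', mul_comm]

/-- The digits of a uniform point are independent and identically distributed. -/
theorem bernoulliProduct_eq_bernPi (I : Type*) [Encodable I] {p : ℝ} (hp₀ : 0 < p) (hp₁ : p < 1) :
    bernoulliProduct I p = bernPi fun _ => p := by
  have hm : Measurable fun x n => bernDigit p n x :=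
    measurable_pi_lambda _ fun n => measurable_bernDigit p n
  have hℕ : uniform.map (fun x n => bernDigit p n x) = infinitePi fun _ : ℕ => bern p := by
    classical
    refine eq_infinitePi _ fun s t ht => ?_
    obtain ⟨N, hN⟩ : ∃ N, ∀ i ∈ s, i < N := ⟨s.sup id + 1, fun i hi =>
      Nat.lt_succ_of_le (Finset.le_sup (f := id) hi)⟩
    rw [map_apply hm (MeasurableSet.pi s.countable_toSet fun i _ => ht i)]
    have hset : (fun x n => bernDigit p n x) ⁻¹' (s : Set ℕ).pi t =
        {x | ∀ i < N, bernDigit p i x ∈ if i ∈ s then t i else Set.univ} := by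
      ext x
      simp only [Set.mem_preimage, Set.mem_pi, Finset.mem_coe, Set.mem_ofPred_eq]
      constructor
      · intro h i _
        split_ifs with hi
        · exact h i hi
        · trivial
      · intro h i hi
        simpa [hi] using h i (hN i hi)
    rw [hset, uniform_digits hp₀ hp₁]
    have hsub : s ⊆ Finset.range N := fun i hi => Finset.mem_range.2 (hN i hi)
    rw [← Finset.prod_subset hsub fun i _ hi => by rw [if_neg hi, measure_univ]]
    exact Finset.prod_congr rfl fun i hi => by simp [hi]
  have hcomp : (fun x (i : I) => bernDigit p (Encodable.encode i) x) =
      (fun (ω : ℕ → Bool) (i : I) => ω (Encodable.encode i)) ∘ fun x n => bernDigit p n x := rfl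
  rw [bernoulliProduct, hcomp,
    ← map_map (measurable_pi_lambda _ fun i => measurable_pi_apply _) hm, hℕ,
    map_infinitePi_infinitePi_of_inj Encodable.encode_injective, bernPi]

lemma bernoulliProduct_zero (I : Type*) [Encodable I] :
    bernoulliProduct I 0 = dirac fun _ => false := by
  have h : ∀ᵐ x ∂uniform, (fun i : I => bernDigit 0 (Encodable.encode i) x) = fun _ => false := by
    filter_upwards [ae_restrict_mem measurableSet_Ico] with x hx
    funext i
    have hfix : expand 0 x = x := by simp [expand, hx.1.not_gt]
    simp [bernDigit, Function.iterate_fixed hfix, hx.1]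
  rw [bernoulliProduct, map_congr h, Measure.map_const]
  simp

lemma bernoulliProduct_one (I : Type*) [Encodable I] :
    bernoulliProduct I 1 = dirac fun _ => true := by
  have h : ∀ᵐ x ∂uniform, (fun i : I => bernDigit 1 (Encodable.encode i) x) = fun _ => true := by
    filter_upwards [ae_restrict_mem measurableSet_Ico] with x hx
    funext i
    have hfix : expand 1 x = x := by simp [expand, hx.2]
    simp [bernDigit, Function.iterate_fixed hfix, hx.2]
  rw [bernoulliProduct, map_congr h, Measure.map_const]
  simp

end Digits

section Paths

/-- `v` can be reached from `o` in exactly `n` steps. -/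
def ReachIn {V : Type*} (R : V → V → Prop) (o : V) : ℕ → V → Prop
  | 0, v => v = o
  | n + 1, v => ∃ u, ReachIn R o n u ∧ R u v

/-- König's lemma: a locally finite directed graph in which infinitely many vertices can be
reached from `o` contains an infinite self-avoiding path starting at `o`. -/
theorem exists_injective_path_of_infinite {V : Type*} {R : V → V → Prop} {o : V}
    (hR : ∀ v, {w | R v w}.Finite) (hinf : {v | Relation.ReflTransGen R o v}.Infinite) :
    ∃ γ : ℕ → V, γ 0 = o ∧ Function.Injective γ ∧ ∀ n, R (γ n) (γ (n + 1)) := by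
  let d : V → ℕ := fun v => sInf {n | ReachIn R o n v}
  let T : V → V → Prop := fun u v => R u v ∧ d v = d u + 1
  have hgeo (n : ℕ) : ∀ v, ReachIn R o n v → d v = n → Relation.ReflTransGen T o v := by
    induction n with
    | zero =>
      rintro v rfl -
      exact .refl
    | succ n ih =>
      rintro v ⟨u, hu, huv⟩ hv
      have h₁ : d u ≤ n := Nat.sInf_le hu
      have h₂ : ReachIn R o (d u) u := Nat.sInf_mem (s := {n | ReachIn R o n u}) ⟨n, hu⟩
      have h₃ : d v ≤ d u + 1 := Nat.sInf_le ⟨u, h₂, huv⟩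
      have h₄ : d u = n := by omega
      exact (ih u hu h₄).tail ⟨huv, by omega⟩
  have hreach {v : V} (h : Relation.ReflTransGen R o v) : ∃ n, ReachIn R o n v := by
    induction h with
    | refl => exact ⟨0, rfl⟩
    | tail _ h ih =>
      obtain ⟨n, hn⟩ := ih
      exact ⟨n + 1, _, hn, h⟩
  let Good : V → Prop := fun u => {v | Relation.ReflTransGen T u v}.Infinite
  have ho : Good o := hinf.mono fun v hv => hgeo _ v (Nat.sInf_mem (hreach hv)) rfl
  have hsucc (u : V) (hu : Good u) : ∃ w, T u w ∧ Good w := by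
    by_contra! hcon
    refine hu (Set.Finite.subset ((Set.finite_singleton u).union
      (Set.Finite.biUnion ((hR u).subset fun w (hw : T u w) => hw.1)
        fun w hw => Set.not_infinite.1 (hcon w hw))) fun v hv => ?_)
    rcases Relation.ReflTransGen.cases_head hv with rfl | ⟨w, hw, hwv⟩
    · exact Or.inl rfl
    · exact Or.inr (Set.mem_biUnion (x := w) hw hwv)
  choose! next hnext using hsucc
  let γ : ℕ → V := fun n => next^[n] o
  have hγ (n : ℕ) : Good (γ n) := by
    induction n with
    | zero => exact ho
    | succ n ih =>
      simp only [γ, Function.iterate_succ_apply']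
      exact (hnext _ ih).2
  have hstep (n : ℕ) : T (γ n) (γ (n + 1)) := by
    simp only [γ, Function.iterate_succ_apply']
    exact (hnext _ (hγ n)).1
  have hd (n : ℕ) : d (γ n) = d o + n := by
    induction n with
    | zero => rfl
    | succ n ih => rw [(hstep n).2, ih, add_assoc]
  refine ⟨γ, rfl, fun m n h => ?_, fun n => (hstep n).1⟩
  have := congrArg d h
  rw [hd, hd] at this
  omega

lemma finite_setOf_slabStep (ω : Config3) (v : ℤ × ℤ × ℤ) : {w | slabStep ω v w}.Finite := by
  refine (Set.finite_Icc (v - 1) (v + 1)).subset ?_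
  rintro ⟨x, y, z⟩ ⟨⟨⟨⟨a, b, c⟩, i⟩, h⟩, -⟩
  fin_cases i <;> rcases h with ⟨rfl, h, -⟩ | ⟨h, rfl, -⟩ <;>
    simp [e3Src, e3Dst] at h <;> simp [e3Src, e3Dst, Prod.le_def] <;> omega

/-- If the origin leaves every box in the square lattice, then the slab percolates. -/
lemma percolates3_of_exitEvent {ω : Config3}
    (h : ∀ n, slabState ω ∈ sq.exitEvent Set.univ (box n) 0) : percolates3 (gStep3 ω) slab := by
  have hinf : {v | Relation.ReflTransGen (slabStep ω) (0, 0, 0) v}.Infinite := by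
    intro hfin
    obtain ⟨k, hk⟩ := exists_subset_box (hfin.toFinset.image fun v => (v.1, v.2.1))
    obtain ⟨b, hb, hconn⟩ := h k
    refine hb (hk (Finset.mem_image.2 ⟨layer b, ?_, rfl⟩))
    rw [Set.Finite.mem_toFinset]
    exact reflTransGen_slabStep_of_conn hconn
  obtain ⟨γ, h₀, hinj, hstep⟩ := exists_injective_path_of_infinite (finite_setOf_slabStep ω) hinf
  exact ⟨γ, h₀, hinj, fun n => (hstep n).1, fun n => (hstep n).2.1⟩

lemma percolates3_const (b : Bool) : percolates3 (gStep3 fun _ => b) slab := by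
  cases b
  · refine ⟨fun n => (-n, 0, 0), by simp, fun m n h => by simpa using h, fun n => ?_,
      fun n => by simp [slab]⟩
    exact ⟨((-(n + 1 : ℕ), 0, 0), 0), Or.inr ⟨rfl, by simp [e3Dst], rfl⟩⟩
  · refine ⟨fun n => (n, 0, 0), by simp, fun m n h => by simpa using h, fun n => ?_,
      fun n => by simp [slab]⟩
    exact ⟨((n, 0, 0), 0), Or.inl ⟨rfl, by simp [e3Dst], rfl⟩⟩

end Paths

lemma measure_percolates3_pos {p : ℝ} (hp₀ : 0 < p) (hp₁ : p < 1) :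
    0 < mu3 p {ω | percolates3 (gStep3 ω) slab} := by
  rw [mu3, bernoulliProduct_eq_bernPi Edge3 hp₀ hp₁]
  let E : ℕ → Set Config3 := fun n => slabState ⁻¹' sq.exitEvent Set.univ (box n) 0
  have hE (n : ℕ) : MeasurableSet (E n) :=
    measurable_slabState (sq.measurableSet_exitEvent _ _ _)
  have hanti : Antitone E := by
    rintro m n hmn ω ⟨b, hb, h⟩
    exact ⟨b, fun hbm => hb (box_mono hmn hbm), h⟩
  have hsub : ⋂ n, E n ⊆ {ω | percolates3 (gStep3 ω) slab} := fun ω hω =>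
    percolates3_of_exitEvent fun n => Set.mem_iInter.1 hω n
  refine lt_of_lt_of_le ?_ (measure_mono hsub)
  have hlim := tendsto_measure_iInter_atTop (μ := bernPi fun _ : Edge3 => p)
    (fun n => (hE n).nullMeasurableSet) hanti ⟨0, measure_ne_top _ _⟩
  have hc : 0 < 1 - Real.exp (-(p ^ 2 * (1 - p) ^ 2 / 2)) := by
    have : 0 < 1 - p := by linarith
    rw [sub_pos, Real.exp_lt_one_iff, neg_lt_zero]
    positivity
  refine lt_of_lt_of_le (ENNReal.ofReal_pos.2 hc) (ge_of_tendsto' hlim fun n => ?_)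
  exact (ENNReal.ofReal_le_iff_le_toReal (measure_ne_top _ _)).2
    (one_sub_exp_le_slabState hp₀.le hp₁.le n)

/-- For every `p ∈ [0,1]`, the `3`-dimensional Grimmett random-orientation model
confined to the slab `ℤ² × {-1, 0, 1}` percolates: with strictly positive
probability there is an infinite directed self-avoiding path from the origin
using only vertices of the slab. -/
theorem grimmett_slab_percolates (p : ℝ) (hp0 : 0 ≤ p) (hp1 : p ≤ 1) :
    0 < mu3 p {ω | percolates3 (gStep3 ω) slab} := by
  rcases hp0.eq_or_lt with rfl | hp0
  · have h : (fun _ => false : Config3) ∈ {ω | percolates3 (gStep3 ω) slab} :=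
      percolates3_const false
    rw [mu3, bernoulliProduct_zero, Measure.dirac_apply_of_mem h]
    exact one_pos
  rcases hp1.eq_or_lt with rfl | hp1
  · have h : (fun _ => true : Config3) ∈ {ω | percolates3 (gStep3 ω) slab} :=
      percolates3_const true
    rw [mu3, bernoulliProduct_one, Measure.dirac_apply_of_mem h]
    exact one_pos
  exact measure_percolates3_pos hp0 hp1

end RandomOrientation
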